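/- arXiv:dg-ga/9702016 — 5 statements merged into one kernel-verified Lean document; each statement's English description precedes it below -/
import Mathlib

section
/- Let f : (Fin n → ℝ) → (Fin n → ℝ) be a C^∞ diffeomorphism (a bijection with f and f⁻¹ both C^∞), let F : ((Fin n) → ℝ) × ((Fin m) → ℝ) → ((Fin m) → ℝ) be C^∞, and let g, h : (Fin n → ℝ) → ((Fin m) → ℝ) be C^∞. Fix r ∈ ℕ and a point x. If iteratedFDeriv ℝ k g x = iteratedFDeriv ℝ k h x for all k ≤ r, then the transformed maps ḡ := u ↦ F(f⁻¹ u, g(f⁻¹ u)) and h̄ := u ↦ F(f⁻¹ u, h(f⁻¹ u)) satisfy iteratedFDeriv ℝ k ḡ (f x) = iteratedFDeriv ℝ k h̄ (f x) for all k ≤ r. (Chart independence of the relation 'two sections have the same partial derivatives up to order r at a point' under fibered chart transformations.) -/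
/-- Jets of a composition depend only on the jets of the factors. -/
theorem jet_comp_aux {E F G : Type*} [NormedAddCommGroup E] [NormedSpace ℝ E]
    [NormedAddCommGroup F] [NormedSpace ℝ F] [NormedAddCommGroup G] [NormedSpace ℝ G]
    {p q : F → G} {a b : E → F}
    (hp : ContDiff ℝ (⊤:ℕ∞) p) (hq : ContDiff ℝ (⊤:ℕ∞) q)
    (ha : ContDiff ℝ (⊤:ℕ∞) a) (hb : ContDiff ℝ (⊤:ℕ∞) b) (x : E) (r : ℕ)
    (hpq : ∀ j : ℕ, j ≤ r → iteratedFDeriv ℝ j p (a x) = iteratedFDeriv ℝ j q (b x))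
    (hab : ∀ j : ℕ, j ≤ r → iteratedFDeriv ℝ j a x = iteratedFDeriv ℝ j b x) :
    ∀ k : ℕ, k ≤ r → iteratedFDeriv ℝ k (p ∘ a) x = iteratedFDeriv ℝ k (q ∘ b) x := by
  intro k hk
  rw [iteratedFDeriv_comp hp.contDiffAt ha.contDiffAt (by exact_mod_cast le_top),
    iteratedFDeriv_comp hq.contDiffAt hb.contDiffAt (by exact_mod_cast le_top)]
  simp only [FormalMultilinearSeries.taylorComp]
  refine Finset.sum_congr rfl fun c _ => ?_
  ext1 v
  simp only [FormalMultilinearSeries.compAlongOrderedFinpartition_apply, ftaylorSeries]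
  rw [hpq _ (c.length_le.trans hk)]
  congr 1
  funext i
  simp only [OrderedFinpartition.applyOrderedFinpartition_apply]
  rw [hab _ ((c.partSize_le i).trans hk)]

/-- chart independence of the relation "two sections have the same partial
derivatives up to order `r` at a point" under fibered chart transformations. -/
theorem jet_equivalence_chart_independent (n m r : ℕ) (hn : 1 ≤ n) (hm : 1 ≤ m)
    (f : (Fin n → ℝ) → (Fin n → ℝ)) (hfbij : Function.Bijective f)
    (hf : ContDiff ℝ (⊤:ℕ∞) f) (hfinv : ContDiff ℝ (⊤:ℕ∞) (Function.invFun f))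
    (F : ((Fin n) → ℝ) × ((Fin m) → ℝ) → ((Fin m) → ℝ)) (hF : ContDiff ℝ (⊤:ℕ∞) F)
    (g h : (Fin n → ℝ) → (Fin m → ℝ))
    (hg : ContDiff ℝ (⊤:ℕ∞) g) (hh : ContDiff ℝ (⊤:ℕ∞) h)
    (x : Fin n → ℝ)
    (heq : ∀ k : ℕ, k ≤ r → iteratedFDeriv ℝ k g x = iteratedFDeriv ℝ k h x) :
    ∀ k : ℕ, k ≤ r →
      iteratedFDeriv ℝ k (fun u => F (Function.invFun f u, g (Function.invFun f u))) (f x)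
        = iteratedFDeriv ℝ k (fun u => F (Function.invFun f u, h (Function.invFun f u)))
            (f x) := by
  intro k hk
  have hx : Function.invFun f (f x) = x := Function.leftInverse_invFun hfbij.1 x
  have hpair : ∀ j : ℕ, j ≤ r →
      iteratedFDeriv ℝ j (fun y => (y, g y)) x = iteratedFDeriv ℝ j (fun y => (y, h y)) x := by
    intro j hj
    have hid : ContDiff ℝ (⊤:ℕ∞) (fun y : Fin n → ℝ => y) := contDiff_id
    rw [iteratedFDeriv_prodMk hid.contDiffAt hg.contDiffAt (by exact_mod_cast le_top),
      iteratedFDeriv_prodMk hid.contDiffAt hh.contDiffAt (by exact_mod_cast le_top), heq j hj]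
  have hg2 : ContDiff ℝ (⊤:ℕ∞) (fun y => (y, g y)) := contDiff_id.prodMk hg
  have hh2 : ContDiff ℝ (⊤:ℕ∞) (fun y => (y, h y)) := contDiff_id.prodMk hh
  have hFj : ∀ j : ℕ, j ≤ r →
      iteratedFDeriv ℝ j (F ∘ fun y => (y, g y)) x
        = iteratedFDeriv ℝ j (F ∘ fun y => (y, h y)) x := by
    have h0 : g x = h x := by
      have := congrArg (fun q => q 0) (heq 0 (Nat.zero_le _))
      simpa using this
    exact jet_comp_aux hF hF hg2 hh2 x r (fun j _ => by simp only [h0]) hpair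
  exact jet_comp_aux (hF.comp hg2) (hF.comp hh2) hfinv hfinv (f x) r
    (fun j hj => by rw [hx]; exact hFj j hj) (fun _ _ => rfl) k hk
end

section
/- Let f be a C^∞ diffeomorphism of (Fin n → ℝ) and let F : ((Fin n) → ℝ) × ((Fin m) → ℝ) → ((Fin m) → ℝ) be C^∞. Then there exists a C^∞ map Φ : J^r → J^r such that: (a) for every C^∞ map g : ((Fin n) → ℝ) → ((Fin m) → ℝ) and every x, Φ(j^r g (x)) = j^r ḡ (f x), where ḡ := u ↦ F(f⁻¹ u, g(f⁻¹ u)); (b) the x-components of Φ are (x,y) ↦ f(x) and the y^σ_0-components are (x,y) ↦ F(x, (y^ν_0)_ν)^σ; and (c) for each σ ∈ Fin m and each multi-index J with 1 ≤ |J| ≤ r, the y^σ_J-component of Φ is a finite sum Σ_p c_p(x, (y^ν_0)_ν) · m_p, where each c_p is a C^∞ function of the coordinates (x, y_0) only and each m_p is a monomial in the coordinates y^ν_K with 1 ≤ |K| ≤ |J|. -/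
open scoped BigOperators

namespace JetVar

/-- Multi-indices on `Fin n` of degree at most `r`. -/
abbrev MD (n r : ℕ) : Type := {J : Fin n → ℕ // (∑ i, J i) ≤ r}

noncomputable instance (n r : ℕ) : Fintype (MD n r) :=
  Fintype.ofInjective
    (fun J : MD n r => fun i : Fin n =>
      (⟨J.1 i, Nat.lt_succ_of_le ((Finset.single_le_sum
        (fun j _ => Nat.zero_le (J.1 j)) (Finset.mem_univ i)).trans J.2)⟩ : Fin (r+1)))
    (fun _a _b h => Subtype.ext (funext fun i => congrArg Fin.val (congrFun h i)))

/-- Index set for the `y` coordinates of the `r`-th order jet space. -/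
abbrev JIdx (n m r : ℕ) : Type := Fin m × MD n r

/-- The `r`-th order jet coordinate space. -/
abbrev Jet (n m r : ℕ) : Type := ((Fin n) → ℝ) × (JIdx n m r → ℝ)

variable {n m : ℕ}

/-- The coordinate `x^i`. -/
def xc (i : Fin n) {r : ℕ} (p : Jet n m r) : ℝ := p.1 i

/-- The coordinate `y^σ_J` (with the convention that it is `0` for `|J| > r`). -/
def yc (σ : Fin m) (J : Fin n → ℕ) {r : ℕ} (p : Jet n m r) : ℝ :=
  if h : (∑ i, J i) ≤ r then p.2 (σ, ⟨J, h⟩) else 0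

/-- Partial derivative along the coordinate direction `x^i`. -/
noncomputable def pdX (i : Fin n) {r : ℕ} (f : Jet n m r → ℝ) (p : Jet n m r) : ℝ :=
  fderiv ℝ f p (Pi.single i 1, 0)

/-- Partial derivative along the coordinate direction `y^σ_J`
(by convention `0` for `|J| > r`). -/
noncomputable def pdY (σ : Fin m) (J : Fin n → ℕ) {r : ℕ} (f : Jet n m r → ℝ)
    (p : Jet n m r) : ℝ :=
  if h : (∑ i, J i) ≤ r then fderiv ℝ f p (0, Pi.single (σ, (⟨J, h⟩ : MD n r)) 1) else 0

/-- Projection `J^s → J^r` for `r ≤ s`, forgetting higher order coordinates. -/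
def projJet {r s : ℕ} (h : r ≤ s) (p : Jet n m s) : Jet n m r :=
  (p.1, fun q => p.2 (q.1, ⟨q.2.1, q.2.2.trans h⟩))

/-- `J + e_i`. -/
def addE (J : Fin n → ℕ) (i : Fin n) : Fin n → ℕ := fun j => J j + (if j = i then 1 else 0)

/-- `J - e_i` (truncated subtraction). -/
def subE (J : Fin n → ℕ) (i : Fin n) : Fin n → ℕ := fun j => J j - (if j = i then 1 else 0)

/-- The `i`-th formal (total) derivative of a function on `J^r`, a function on `J^{r+1}`. -/
noncomputable def formalD (i : Fin n) {r : ℕ} (f : Jet n m r → ℝ) (p : Jet n m (r+1)) : ℝ :=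
  pdX i f (projJet (Nat.le_succ r) p)
    + ∑ q : JIdx n m r, yc q.1 (addE q.2.1 i) p * pdY q.1 q.2.1 f (projJet (Nat.le_succ r) p)

/-- Iterated formal derivatives along a list of directions. -/
noncomputable def formalDL {r : ℕ} : (l : List (Fin n)) → (Jet n m r → ℝ) →
    (Jet n m (r + l.length) → ℝ)
  | [], f => f
  | i :: l, f => formalD i (formalDL l f)

/-- The canonical list of directions attached to a multi-index
(each `i` repeated `J i` times, in increasing order of `i`). -/
def mlist (J : Fin n → ℕ) : List (Fin n) :=
  (List.finRange n).flatMap (fun i => List.replicate (J i) i)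

lemma mlist_length (J : Fin n → ℕ) : (mlist J).length = ∑ i, J i := by
  rw [mlist, List.length_flatMap]
  simp only [Function.comp_def, List.length_replicate]
  rw [Fin.sum_univ_def]

/-- The iterated formal derivative `d_I`, applying each `d_i` exactly `I i` times
(in increasing order of `i`); a function on `J^{r+|I|}`. -/
noncomputable def formalDI (I : Fin n → ℕ) {r : ℕ} (f : Jet n m r → ℝ)
    (p : Jet n m (r + ∑ i, I i)) : ℝ :=
  formalDL (mlist I) f (projJet (le_of_eq (by rw [mlist_length])) p)

/-- The Lie–Euler expression `E^I_σ(L)` of a function `L` on `J^r`, a function on `J^{2r}`. -/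
noncomputable def LieEuler {r : ℕ} (σ : Fin m) (I : Fin n → ℕ) (L : Jet n m r → ℝ)
    (p : Jet n m (2*r)) : ℝ :=
  ∑ J : MD n r,
    if h : (∑ i, (I i + J.1 i)) ≤ r then
      (-1:ℝ)^(∑ i, J.1 i) * (∏ i, (Nat.choose (I i + J.1 i) (I i) : ℝ)) *
        formalDI J.1 (pdY σ (fun i => I i + J.1 i) L)
          (projJet (by have := J.2; omega) p)
    else 0

/-- The Euler–Lagrange expression `E_σ(L)`. -/
noncomputable def EL {r : ℕ} (σ : Fin m) (L : Jet n m r → ℝ) : Jet n m (2*r) → ℝ :=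
  LieEuler σ (fun _ => 0) L


/-- Directional derivative of a function on the base space. -/
noncomputable def dirD {n : ℕ} (i : Fin n) (h : (Fin n → ℝ) → ℝ) : (Fin n → ℝ) → ℝ :=
  fun x => fderiv ℝ h x (Pi.single i 1)

/-- Iterated directional derivatives along a list of directions. -/
noncomputable def iterD {n : ℕ} : List (Fin n) → ((Fin n → ℝ) → ℝ) → ((Fin n → ℝ) → ℝ)
  | [], h => h
  | i :: l, h => iterD l (dirD i h)

/-- The `r`-jet prolongation of a map `g : ℝ^n → ℝ^m`. -/
noncomputable def jetProl {n m : ℕ} (r : ℕ) (g : (Fin n → ℝ) → (Fin m → ℝ))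
    (x : Fin n → ℝ) : Jet n m r :=
  (x, fun q => iterD (mlist q.2.1) (fun z => g z q.1) x)

/-- The underlying point of `J^0`. -/
def Ypt {n m r : ℕ} (p : Jet n m r) : (Fin n → ℝ) × (Fin m → ℝ) :=
  (p.1, fun ν => yc ν (fun _ => 0) p)

lemma yc_zero {n m r : ℕ} (p : Jet n m r) (ν : Fin m) :
    yc ν (fun _ => 0) p = p.2 (ν, ⟨fun _ => 0, by simp⟩) := by
  simp [yc]

lemma contDiff_Ypt {n m r : ℕ} : ContDiff ℝ (⊤:ℕ∞) (Ypt : Jet n m r → _) := by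
  unfold Ypt
  simp only [yc_zero]
  fun_prop

lemma mlist_zero {n : ℕ} : mlist (fun _ : Fin n => 0) = [] := by
  simp [mlist]

lemma contDiff_dirD {n : ℕ} (i : Fin n) {h : (Fin n → ℝ) → ℝ} (hh : ContDiff ℝ (⊤:ℕ∞) h) :
    ContDiff ℝ (⊤:ℕ∞) (dirD i h) := by
  unfold dirD
  exact (hh.fderiv_right (m := (⊤:ℕ∞)) (by simp)).clm_apply contDiff_const

lemma contDiff_iterD {n : ℕ} (l : List (Fin n)) {h : (Fin n → ℝ) → ℝ}
    (hh : ContDiff ℝ (⊤:ℕ∞) h) : ContDiff ℝ (⊤:ℕ∞) (iterD l h) := by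
  induction l generalizing h with
  | nil => exact hh
  | cons i l ih => exact ih (contDiff_dirD i hh)

lemma dirD_comm {n : ℕ} (i j : Fin n) {h : (Fin n → ℝ) → ℝ} (hh : ContDiff ℝ (⊤:ℕ∞) h) :
    dirD i (dirD j h) = dirD j (dirD i h) := by
  funext x
  have hd : DifferentiableAt ℝ (fderiv ℝ h) x :=
    ((hh.fderiv_right (m := (⊤:ℕ∞)) (by simp)).differentiable (by simp)) x
  have hs : IsSymmSndFDerivAt ℝ h x :=
    hh.contDiffAt.isSymmSndFDerivAt (by
      rw [minSmoothness_of_isRCLikeNormedField]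
      exact WithTop.coe_le_coe.2 le_top)
  have key : ∀ v w : Fin n → ℝ,
      fderiv ℝ (fun z => fderiv ℝ h z v) x w = fderiv ℝ (fderiv ℝ h) x w v := by
    intro v w
    rw [fderiv_clm_apply hd (differentiableAt_const v)]
    simp
  unfold dirD
  rw [key, key]
  exact hs.eq _ _

lemma iterD_perm {n : ℕ} {l l' : List (Fin n)} (hl : l.Perm l') {h : (Fin n → ℝ) → ℝ}
    (hh : ContDiff ℝ (⊤:ℕ∞) h) : iterD l h = iterD l' h := by
  induction hl generalizing h with
  | nil => rfl
  | cons i _ ih => exact ih (contDiff_dirD i hh)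
  | swap i j l => simp only [iterD]; rw [dirD_comm _ _ hh]
  | trans _ _ ih1 ih2 => exact (ih1 hh).trans (ih2 hh)

lemma dirD_iterD {n : ℕ} (l : List (Fin n)) (j : Fin n) {h : (Fin n → ℝ) → ℝ}
    (hh : ContDiff ℝ (⊤:ℕ∞) h) : dirD j (iterD l h) = iterD (j :: l) h := by
  induction l generalizing h with
  | nil => rfl
  | cons i l ih =>
    have := ih (contDiff_dirD i hh)
    simp only [iterD] at this ⊢
    rw [this, dirD_comm _ _ hh]

lemma count_mlist {n : ℕ} (J : Fin n → ℕ) (i : Fin n) : (mlist J).count i = J i := by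
  rw [mlist, List.count_flatMap]
  simp only [Function.comp_def, List.count_replicate]
  rw [← Fin.sum_univ_def]
  simp

lemma mlist_addE {n : ℕ} (J : Fin n → ℕ) (j : Fin n) : (mlist (addE J j)).Perm (j :: mlist J) := by
  rw [List.perm_iff_count]
  intro i
  rw [count_mlist, List.count_cons, count_mlist, addE]
  by_cases h : i = j
  · simp [h]
  · simp [h, Ne.symm h]

lemma sum_addE {n : ℕ} (J : Fin n → ℕ) (j : Fin n) : ∑ i, addE J j i = (∑ i, J i) + 1 := by
  simp [addE, Finset.sum_add_distrib]

lemma dirD_mlist {n : ℕ} (J : Fin n → ℕ) (j : Fin n) {h : (Fin n → ℝ) → ℝ}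
    (hh : ContDiff ℝ (⊤:ℕ∞) h) : dirD j (iterD (mlist J) h) = iterD (mlist (addE J j)) h := by
  rw [dirD_iterD _ _ hh, iterD_perm (mlist_addE J j) hh]

/-- Differential polynomials of order at most `k`. -/
inductive Good (n m r k : ℕ) : (Jet n m r → ℝ) → Prop
  | coef (c : (Fin n → ℝ) × (Fin m → ℝ) → ℝ) (hc : ContDiff ℝ (⊤:ℕ∞) c) :
      Good n m r k (fun p => c (Ypt p))
  | coord (q : JIdx n m r) (h1 : 1 ≤ ∑ i, q.2.1 i) (h2 : (∑ i, q.2.1 i) ≤ k) :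
      Good n m r k (fun p => p.2 q)
  | add {P Q : Jet n m r → ℝ} : Good n m r k P → Good n m r k Q →
      Good n m r k (fun p => P p + Q p)
  | mul {P Q : Jet n m r → ℝ} : Good n m r k P → Good n m r k Q →
      Good n m r k (fun p => P p * Q p)

lemma Good.mono {n m r k k' : ℕ} (hk : k ≤ k') {P : Jet n m r → ℝ} (h : Good n m r k P) :
    Good n m r k' P := by
  induction h with
  | coef c hc => exact .coef c hc
  | coord q h1 h2 => exact .coord q h1 (h2.trans hk)
  | add _ _ h1 h2 => exact .add h1 h2
  | mul _ _ h1 h2 => exact .mul h1 h2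

lemma Good.contDiff {n m r k : ℕ} {P : Jet n m r → ℝ} (h : Good n m r k P) :
    ContDiff ℝ (⊤:ℕ∞) P := by
  induction h with
  | coef c hc => exact hc.comp contDiff_Ypt
  | coord q h1 h2 => fun_prop
  | add _ _ h1 h2 => exact h1.add h2
  | mul _ _ h1 h2 => exact h1.mul h2

lemma Good.sum {n m r k : ℕ} {ι : Type} (s : Finset ι) {P : ι → Jet n m r → ℝ}
    (h : ∀ i, Good n m r k (P i)) : Good n m r k (fun p => ∑ i ∈ s, P i p) := by
  classical
  induction s using Finset.induction_on with
  | empty =>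
    simp only [Finset.sum_empty]
    exact Good.coef (fun _ => (0:ℝ)) contDiff_const
  | insert a s ha ih =>
    simp only [Finset.sum_insert ha]
    exact (h a).add ih

lemma Good.normal {n m r k : ℕ} {P : Jet n m r → ℝ} (h : Good n m r k P) :
    ∃ (ι : Type) (_ : Fintype ι) (c : ι → ((Fin n → ℝ) × (Fin m → ℝ)) → ℝ)
      (e : ι → JIdx n m r → ℕ),
      (∀ a, ContDiff ℝ (⊤:ℕ∞) (c a)) ∧
      (∀ a q, e a q ≠ 0 → 1 ≤ (∑ i, q.2.1 i) ∧ (∑ i, q.2.1 i) ≤ k) ∧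
      (∀ p, P p = ∑ a, c a (Ypt p) * ∏ q, (p.2 q) ^ (e a q)) := by
  classical
  induction h with
  | coef c hc =>
    exact ⟨Unit, inferInstance, fun _ => c, fun _ _ => 0, fun _ => hc, by simp, by simp⟩
  | coord q h1 h2 =>
    refine ⟨Unit, inferInstance, fun _ _ => 1, fun _ q' => if q' = q then 1 else 0,
      fun _ => contDiff_const, ?_, ?_⟩
    · intro _ q' hq
      have : q' = q := by
        by_contra hne
        simp [hne] at hq
      rw [this]
      exact ⟨h1, h2⟩
    · intro p
      simp [pow_ite]
  | add _ _ h1 h2 =>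
    obtain ⟨ι, _, c, e, hc, he, hP⟩ := h1
    obtain ⟨ι', _, c', e', hc', he', hP'⟩ := h2
    refine ⟨ι ⊕ ι', inferInstance, Sum.elim c c', Sum.elim e e', ?_, ?_, ?_⟩
    · rintro (a | a)
      · exact hc a
      · exact hc' a
    · rintro (a | a)
      · exact he a
      · exact he' a
    · intro p
      simp [hP, hP']
  | mul _ _ h1 h2 =>
    obtain ⟨ι, _, c, e, hc, he, hP⟩ := h1
    obtain ⟨ι', _, c', e', hc', he', hP'⟩ := h2
    refine ⟨ι × ι', inferInstance, fun a z => c a.1 z * c' a.2 z,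
      fun a q => e a.1 q + e' a.2 q, ?_, ?_, ?_⟩
    · intro a
      exact (hc a.1).mul (hc' a.2)
    · intro a q hq
      simp only [ne_eq] at hq
      by_cases h0 : e a.1 q = 0
      · exact he' a.2 q (by omega)
      · exact he a.1 q h0
    · intro p
      simp only
      rw [hP, hP', Finset.sum_mul_sum, Fintype.sum_prod_type]
      refine Finset.sum_congr rfl fun a _ => Finset.sum_congr rfl fun b _ => ?_
      simp only [pow_add, Finset.prod_mul_distrib]
      ring

lemma contDiff_jetProl {n m : ℕ} (r : ℕ) {g : (Fin n → ℝ) → (Fin m → ℝ)}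
    (hg : ContDiff ℝ (⊤:ℕ∞) g) : ContDiff ℝ (⊤:ℕ∞) (jetProl r g) := by
  unfold jetProl
  refine contDiff_id.prodMk (contDiff_pi.2 fun q => contDiff_iterD _ ?_)
  exact contDiff_pi.1 hg q.1

lemma Ypt_jetProl {n m r : ℕ} (g : (Fin n → ℝ) → (Fin m → ℝ)) (x : Fin n → ℝ) :
    Ypt (jetProl r g x) = (x, g x) := by
  unfold Ypt
  simp only [yc_zero]
  simp [jetProl, mlist_zero, iterD]

/-- Total derivatives of differential polynomials. -/
lemma Good.total {n m r k : ℕ} (hk : k + 1 ≤ r) (j : Fin n) {P : Jet n m r → ℝ}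
    (h : Good n m r k P) :
    ∃ Q, Good n m r (k+1) Q ∧ ∀ g : (Fin n → ℝ) → (Fin m → ℝ), ContDiff ℝ (⊤:ℕ∞) g →
      ∀ x, dirD j (fun z => P (jetProl r g z)) x = Q (jetProl r g x) := by
  have hdiff : ∀ {P : Jet n m r → ℝ}, Good n m r k P → ∀ {g : (Fin n → ℝ) → (Fin m → ℝ)},
      ContDiff ℝ (⊤:ℕ∞) g → ∀ x, DifferentiableAt ℝ (fun z => P (jetProl r g z)) x := by
    intro P hP g hg x
    exact ((hP.contDiff.comp (contDiff_jetProl r hg)).differentiable (by simp)) x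
  induction h with
  | coef c hc =>
    have hc' : ContDiff ℝ (⊤:ℕ∞) (fderiv ℝ c) := hc.fderiv_right (by simp)
    have hsum : ∑ i, addE (fun _ : Fin n => 0) j i = 1 := by rw [sum_addE]; simp
    let q : Fin m → JIdx n m r := fun ν => (ν, ⟨addE (fun _ => 0) j, by omega⟩)
    refine ⟨fun p => fderiv ℝ c (Ypt p) (Pi.single j 1, 0) +
      ∑ ν, p.2 (q ν) * fderiv ℝ c (Ypt p) (0, fun μ => if ν = μ then 1 else 0), ?_, ?_⟩
    · refine Good.add (Good.coef (fun y => fderiv ℝ c y (Pi.single j 1, 0))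
        (hc'.clm_apply contDiff_const)) (Good.sum _ fun ν => Good.mul (Good.coord _ ?_ ?_)
        (Good.coef (fun y => fderiv ℝ c y (0, fun μ => if ν = μ then 1 else 0))
          (hc'.clm_apply contDiff_const)))
      · exact hsum.ge
      · exact hsum.le.trans (by omega)
    · intro g hg x
      simp only [Ypt_jetProl]
      have hgd : DifferentiableAt ℝ g x := hg.differentiable (by simp) x
      have hq : ∀ ν, (jetProl r g x).2 (q ν) = fderiv ℝ g x (Pi.single j 1) ν := by
        intro ν
        have h1 := congrFun (dirD_mlist (fun _ => 0) j (contDiff_pi.1 hg ν)) x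
        change iterD (mlist (addE (fun _ => 0) j)) (fun z => g z ν) x = _
        rw [← h1, mlist_zero]
        simp only [iterD, dirD]
        rw [fderiv_apply hgd]
        rfl
      have hcd : HasFDerivAt (fun z => c (z, g z)) _ x :=
        HasFDerivAt.comp x (hc.differentiable (by simp) (x, g x)).hasFDerivAt
          ((hasFDerivAt_id x).prodMk hgd.hasFDerivAt)
      simp only [dirD, hcd.fderiv, hq]
      have hL := LinearMap.pi_apply_eq_sum_univ
        ((fderiv ℝ c (x, g x)).comp (ContinuousLinearMap.inr ℝ _ _)).toLinearMap
        (fderiv ℝ g x (Pi.single j 1))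
      simp only [ContinuousLinearMap.coe_coe, ContinuousLinearMap.comp_apply,
        ContinuousLinearMap.inr_apply, smul_eq_mul] at hL
      rw [← hL, ← map_add]
      simp
  | coord q h1 h2 =>
    have hs := sum_addE q.2.1 j
    refine ⟨fun p => p.2 (q.1, ⟨addE q.2.1 j, by omega⟩), Good.coord _ ?_ ?_, ?_⟩
    · simp only [hs]; omega
    · simp only [hs]; omega
    · intro g hg x
      exact congrFun (dirD_mlist q.2.1 j (contDiff_pi.1 hg q.1)) x
  | @add P P' hP hP' ih ih' =>
    obtain ⟨Q, hQ, e⟩ := ih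
    obtain ⟨Q', hQ', e'⟩ := ih'
    refine ⟨_, hQ.add hQ', fun g hg x => ?_⟩
    rw [← e g hg, ← e' g hg]
    simp only [dirD]
    rw [fderiv_fun_add (hdiff hP hg x) (hdiff hP' hg x)]
    rfl
  | @mul P P' hP hP' ih ih' =>
    obtain ⟨Q, hQ, e⟩ := ih
    obtain ⟨Q', hQ', e'⟩ := ih'
    refine ⟨_, ((hP.mono (Nat.le_succ k)).mul hQ').add ((hP'.mono (Nat.le_succ k)).mul hQ),
      fun g hg x => ?_⟩
    rw [← e g hg, ← e' g hg]
    simp only [dirD]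
    rw [fderiv_fun_mul (hdiff hP hg x) (hdiff hP' hg x)]
    rfl

/-- Derivatives in the transformed base coordinates. -/
lemma Good.chart {n m r k : ℕ} (hk : k + 1 ≤ r) (i : Fin n)
    {f fi : (Fin n → ℝ) → (Fin n → ℝ)} (hf : ContDiff ℝ (⊤:ℕ∞) f) (hfi : ContDiff ℝ (⊤:ℕ∞) fi)
    (hinv : ∀ u, f (fi u) = u) {P : Jet n m r → ℝ} (h : Good n m r k P) :
    ∃ Q, Good n m r (k+1) Q ∧ ∀ g : (Fin n → ℝ) → (Fin m → ℝ), ContDiff ℝ (⊤:ℕ∞) g →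
      dirD i (fun u => P (jetProl r g (fi u))) = fun u => Q (jetProl r g (fi u)) := by
  choose Q hQ hQe using fun j => h.total hk j
  have hfi' : ContDiff ℝ (⊤:ℕ∞) (fderiv ℝ fi) := hfi.fderiv_right (by simp)
  refine ⟨fun p => ∑ j, fderiv ℝ fi (f (Ypt p).1) (Pi.single i 1) j * Q j p, ?_, ?_⟩
  · refine Good.sum _ fun j => Good.mul
      (Good.coef (fun y => fderiv ℝ fi (f y.1) (Pi.single i 1) j) ?_) (hQ j)
    exact contDiff_pi.1
      ((hfi'.comp (hf.comp contDiff_fst)).clm_apply contDiff_const) j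
  · intro g hg
    funext u
    simp only [Ypt_jetProl, hinv, ← hQe _ g hg]
    have hH : ContDiff ℝ (⊤:ℕ∞) (fun z => P (jetProl r g z)) :=
      h.contDiff.comp (contDiff_jetProl r hg)
    have hcd : HasFDerivAt (fun u => P (jetProl r g (fi u))) _ u :=
      HasFDerivAt.comp (g := fun z => P (jetProl r g z)) u (hH.differentiable (by simp) (fi u)).hasFDerivAt
        (hfi.differentiable (by simp) u).hasFDerivAt
    simp only [dirD, hcd.fderiv]
    have hL := LinearMap.pi_apply_eq_sum_univ
      (fderiv ℝ (fun z => P (jetProl r g z)) (fi u)).toLinearMap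
      (fderiv ℝ fi u (Pi.single i 1))
    simp only [ContinuousLinearMap.coe_coe, smul_eq_mul] at hL
    rw [ContinuousLinearMap.comp_apply, hL]
    refine Finset.sum_congr rfl fun j _ => ?_
    congr 2
    funext a
    simp [Pi.single_apply, eq_comm]

lemma Good.iter {n m r : ℕ} {f fi : (Fin n → ℝ) → (Fin n → ℝ)} (hf : ContDiff ℝ (⊤:ℕ∞) f)
    (hfi : ContDiff ℝ (⊤:ℕ∞) fi) (hinv : ∀ u, f (fi u) = u) (l : List (Fin n)) {k : ℕ}
    (hk : k + l.length ≤ r) {P : Jet n m r → ℝ} (h : Good n m r k P) :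
    ∃ Q, Good n m r (k + l.length) Q ∧
      ∀ g : (Fin n → ℝ) → (Fin m → ℝ), ContDiff ℝ (⊤:ℕ∞) g →
      iterD l (fun u => P (jetProl r g (fi u))) = fun u => Q (jetProl r g (fi u)) := by
  induction l generalizing k P with
  | nil => exact ⟨P, h, fun _ _ => rfl⟩
  | cons i l ih =>
    simp only [List.length_cons] at hk ⊢
    obtain ⟨Q, hQ, e⟩ := h.chart (by omega) i hf hfi hinv
    obtain ⟨Q', hQ', e'⟩ := ih (by omega) hQ
    refine ⟨Q', hQ'.mono (by omega), fun g hg => ?_⟩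
    rw [iterD, e g hg, e' g hg]

/-- existence of the smooth jet prolongation of a fibered chart
transformation, with polynomial structure of its highest order components. -/
theorem jet_prolongation_of_chart_transformation (n m r : ℕ) (hn : 1 ≤ n) (hm : 1 ≤ m)
    (f : (Fin n → ℝ) → (Fin n → ℝ)) (hfbij : Function.Bijective f)
    (hf : ContDiff ℝ (⊤:ℕ∞) f) (hfinv : ContDiff ℝ (⊤:ℕ∞) (Function.invFun f))
    (F : ((Fin n) → ℝ) × ((Fin m) → ℝ) → ((Fin m) → ℝ)) (hF : ContDiff ℝ (⊤:ℕ∞) F) :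
    ∃ Φ : Jet n m r → Jet n m r,
      ContDiff ℝ (⊤:ℕ∞) Φ ∧
      -- (a) Φ intertwines jet prolongations with the transformation of sections
      (∀ g : (Fin n → ℝ) → (Fin m → ℝ), ContDiff ℝ (⊤:ℕ∞) g → ∀ x : Fin n → ℝ,
        Φ (jetProl r g x)
          = jetProl r (fun u => F (Function.invFun f u, g (Function.invFun f u))) (f x)) ∧
      -- (b) the `x`- and `y^σ_0`-components of Φ
      (∀ p : Jet n m r, (Φ p).1 = f p.1) ∧
      (∀ (p : Jet n m r) (σ : Fin m),
        yc σ (fun _ => 0) (Φ p) = F (p.1, fun ν => yc ν (fun _ => 0) p) σ) ∧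
      -- (c) polynomial structure of the higher components
      (∀ (σ : Fin m) (J : Fin n → ℕ), 1 ≤ (∑ i, J i) → (∑ i, J i) ≤ r →
        ∃ (N : ℕ) (c : Fin N → ((Fin n → ℝ) × (Fin m → ℝ)) → ℝ)
          (e : Fin N → JIdx n m r → ℕ),
          (∀ a, ContDiff ℝ (⊤:ℕ∞) (c a)) ∧
          (∀ (a : Fin N) (q : JIdx n m r), e a q ≠ 0 →
            1 ≤ (∑ i, q.2.1 i) ∧ (∑ i, q.2.1 i) ≤ ∑ i, J i) ∧
          (∀ p : Jet n m r,
            yc σ J (Φ p)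
              = ∑ a : Fin N,
                  c a (p.1, fun ν => yc ν (fun _ => 0) p) * ∏ q : JIdx n m r, (p.2 q) ^ (e a q))) := by
  classical
  have hr : ∀ u, f (Function.invFun f u) = u := Function.rightInverse_invFun hfbij.2
  have hl : ∀ x, Function.invFun f (f x) = x := Function.leftInverse_invFun hfbij.1
  have hex : ∀ q : JIdx n m r, ∃ P : Jet n m r → ℝ, Good n m r (∑ i, q.2.1 i) P ∧
      (∀ g : (Fin n → ℝ) → (Fin m → ℝ), ContDiff ℝ (⊤:ℕ∞) g → ∀ x,
        P (jetProl r g x) = iterD (mlist q.2.1)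
          (fun u => F (Function.invFun f u, g (Function.invFun f u)) q.1) (f x)) ∧
      ((q.2.1 = fun _ => 0) → P = fun p => F (Ypt p) q.1) := by
    rintro ⟨σ, J, hJ⟩
    have h0 : ∀ k, Good n m r k (fun p => F (Ypt p) σ) :=
      fun k => Good.coef (fun y => F y σ) (contDiff_pi.1 hF σ)
    by_cases hJ0 : J = fun _ => 0
    · subst hJ0
      refine ⟨_, h0 _, fun g hg x => ?_, fun _ => rfl⟩
      simp only [mlist_zero, iterD, Ypt_jetProl, hl]
    · obtain ⟨Q, hQ, e⟩ := (h0 0).iter hf hfinv hr (mlist J) (by rw [mlist_length]; omega)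
      refine ⟨Q, hQ.mono (by rw [mlist_length, Nat.zero_add]), fun g hg x => ?_, fun h => absurd h hJ0⟩
      have := congrFun (e g hg) (f x)
      simp only [Ypt_jetProl, hl] at this
      exact this.symm
  choose P hP hPe hP0 using hex
  refine ⟨fun p => (f p.1, fun q => P q p), ?_, ?_, fun _ => rfl, ?_, ?_⟩
  · exact (hf.comp contDiff_fst).prodMk (contDiff_pi.2 fun q => (hP q).contDiff)
  · intro g hg x
    refine Prod.ext rfl ?_
    funext q
    exact hPe q g hg x
  · intro p σ
    rw [yc_zero]
    exact congrFun (hP0 (σ, ⟨fun _ => 0, by simp⟩) rfl) p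
  · intro σ J _ hJ
    obtain ⟨ι, _, c, e, hc, he, hE⟩ := (hP (σ, ⟨J, hJ⟩)).normal
    let φ := (Fintype.equivFin ι).symm
    refine ⟨Fintype.card ι, fun a => c (φ a), fun a => e (φ a), fun a => hc _,
      fun a q hq => he _ q hq, fun p => ?_⟩
    have h1 : yc σ J ((f p.1, fun q => P q p) : Jet n m r) = P (σ, ⟨J, hJ⟩) p := by
      simp [yc, hJ]
    rw [h1, hE]
    exact (Equiv.sum_comp φ (fun a => c a (Ypt p) * ∏ q, (p.2 q) ^ (e a q))).symm

end JetVar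
end

section
/- Let L and M be real vector spaces, q ∈ ℕ, and ω : L^q → M an alternating multilinear map. Then for all a, b : Fin q → L: ω(a(0)+b(0), …, a(q−1)+b(q−1)) = Σ_{k=0}^{q} (1/(k!(q−k)!)) · Σ_{τ ∈ Perm(Fin q)} sign(τ) · ω(a(τ(0)), …, a(τ(k−1)), b(τ(k)), …, b(τ(q−1))). -/
open scoped BigOperators

/-- The image under `τ` of the first `k` indices. -/
def addDecompImage (q k : ℕ) (τ : Equiv.Perm (Fin q)) : Finset (Fin q) :=
  Finset.univ.filter (fun x => ((τ.symm x : Fin q) : ℕ) < k)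

theorem card_addDecompImage (q k : ℕ) (hk : k ≤ q) (τ : Equiv.Perm (Fin q)) :
    (addDecompImage q k τ).card = k := by
  have h : addDecompImage q k τ
      = (Finset.univ.filter (fun x : Fin q => (x : ℕ) < k)).map τ.toEmbedding := by
    ext x
    simp [addDecompImage, Finset.mem_map_equiv]
  rw [h, Finset.card_map, Fin.card_filter_val_lt]
  omega

theorem card_fiber_addDecompImage (q k : ℕ) (s : Finset (Fin q)) (hs : s.card = k) :
    (Finset.univ.filter (fun τ => addDecompImage q k τ = s)).card
      = k.factorial * (q - k).factorial := by
  have h := Numbering.card_prefixed s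
  rw [hs, Fintype.card_fin] at h
  rw [← h]
  refine Finset.card_bij'
    (fun τ _ => (τ.symm.trans (finCongr (Fintype.card_fin q).symm) : Numbering (Fin q)))
    (fun f _ => (f.trans (finCongr (Fintype.card_fin q))).symm) ?_ ?_ ?_ ?_
  · intro τ hτ
    have hτ' : addDecompImage q k τ = s := by simpa using hτ
    rw [Numbering.mem_prefixed]
    intro x
    rw [hs, ← hτ']
    simp [addDecompImage]
  · intro f hf
    rw [Numbering.mem_prefixed] at hf
    simp only [Finset.mem_filter, Finset.mem_univ, true_and]
    ext x
    rw [hf x, hs]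
    simp [addDecompImage]
  · intro τ _
    ext x
    simp
  · intro f _
    ext x
    simp

/-- decomposition of an alternating multilinear map evaluated on a sum. -/
theorem alternatingMap_add_decomposition (L M : Type*)
    [AddCommGroup L] [Module ℝ L] [AddCommGroup M] [Module ℝ M]
    (q : ℕ) (ω : AlternatingMap ℝ L M (Fin q)) (a b : Fin q → L) :
    ω (fun i => a i + b i)
      = ∑ k ∈ Finset.range (q+1),
          ((1 : ℝ) / ((k.factorial * (q-k).factorial : ℕ) : ℝ)) •
            ∑ τ : Equiv.Perm (Fin q),
              ((Equiv.Perm.sign τ : ℤ)) •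
                ω (fun i => if (i : ℕ) < k then a (τ i) else b (τ i)) := by
  have h0 : ω (fun i => a i + b i) = ∑ s : Finset (Fin q), ω (s.piecewise a b) :=
    ω.map_add_univ a b
  rw [h0, ← Finset.sum_fiberwise_of_maps_to (s := Finset.univ) (t := Finset.range (q + 1))
    (g := fun s : Finset (Fin q) => s.card)
    (fun s _ => by
      have := s.card_le_univ
      rw [Fintype.card_fin] at this
      simp only [Finset.mem_range]
      omega)]
  refine Finset.sum_congr rfl fun k hk => ?_
  have hkq : k ≤ q := by
    rw [Finset.mem_range] at hk
    omega
  have h1 : ∀ τ : Equiv.Perm (Fin q),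
      ((Equiv.Perm.sign τ : ℤ)) • ω (fun i => if (i : ℕ) < k then a (τ i) else b (τ i))
        = ω ((addDecompImage q k τ).piecewise a b) := by
    intro τ
    rw [ω.map_congr_perm τ (v := (addDecompImage q k τ).piecewise a b), Units.smul_def]
    congr 2
    ext i
    simp [addDecompImage, Finset.piecewise]
  rw [Finset.sum_congr rfl (fun τ _ => h1 τ),
    ← Finset.sum_fiberwise_of_maps_to (s := Finset.univ)
      (t := Finset.univ.filter (fun s : Finset (Fin q) => s.card = k))
      (g := addDecompImage q k)
      (fun τ _ => by simp [card_addDecompImage q k hkq τ]), Finset.smul_sum]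
  refine Finset.sum_congr rfl fun s hs => ?_
  have hs' : s.card = k := by simpa using hs
  have h2 : ∑ τ ∈ Finset.univ.filter (fun τ => addDecompImage q k τ = s),
      ω ((addDecompImage q k τ).piecewise a b)
        = (k.factorial * (q - k).factorial) • ω (s.piecewise a b) := by
    rw [← card_fiber_addDecompImage q k s hs', ← Finset.sum_const]
    refine Finset.sum_congr rfl fun τ hτ => ?_
    rw [(Finset.mem_filter.1 hτ).2]
  rw [h2, ← Nat.cast_smul_eq_nsmul ℝ, smul_smul, one_div, inv_mul_cancel₀, one_smul]
  exact Nat.cast_ne_zero.2 (Nat.mul_ne_zero (Nat.factorial_ne_zero _) (Nat.factorial_ne_zero _))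
end

section
/- Let n ≥ 2, let 2 ≤ q ≤ n, and let r_1, …, r_q ∈ ℕ. If X ∈ ℋ_{0; r_1,…,r_q} satisfies (B_1 ∘ B_2 ∘ ⋯ ∘ B_q) X = 0 (each B_α applied on the space produced by the previously applied operators), then X = 0. -/
open scoped BigOperators

namespace FockVar

/-- Multi-indices on `Fin n` of degree exactly `d` (encoding a symmetric slot of rank `d`). -/
abbrev MIe (n d : ℕ) : Type := {J : Fin n → ℕ // (∑ i, J i) = d}

/-- The space of tensors with `k` antisymmetric `Fin n` indices and `s` symmetric slots of
ranks `r 0, …, r (s-1)` (symmetric slots encoded by multi-indices, so that the symmetry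
in each slot is automatic). -/
abbrev TT (n k s : ℕ) (r : Fin s → ℕ) : Type :=
  (Fin k → Fin n) → ((α : Fin s) → MIe n (r α)) → ℝ

/-- Antisymmetry in the `k` `Fin n`-indices: membership in `ℋ_{k;r_1,…,r_s}`. -/
def IsAnti {n k s : ℕ} {r : Fin s → ℕ} (X : TT n k s r) : Prop :=
  ∀ (τ : Equiv.Perm (Fin k)) (i : Fin k → Fin n) (I : (α : Fin s) → MIe n (r α)),
    X (i ∘ τ) I = ((Equiv.Perm.sign τ : ℤ) : ℝ) * X i I

/-- Evaluation of a tensor on raw data, with built-in degree and arity checks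
(returns `0` on mismatch). -/
def appT {n k s : ℕ} {r : Fin s → ℕ} (X : TT n k s r) {k' : ℕ}
    (i : Fin k' → Fin n) (K : Fin s → (Fin n → ℕ)) : ℝ :=
  if h : k' = k ∧ ∀ α, (∑ j, K α j) = r α then
    X (fun a => i (Fin.cast h.1.symm a)) (fun α => ⟨K α, h.2 α⟩)
  else 0

/-- `J - e_{j₀}` (truncated subtraction). -/
def subF {n : ℕ} (J : Fin n → ℕ) (j0 : Fin n) : Fin n → ℕ :=
  fun j => J j - (if j = j0 then 1 else 0)

/-- `J + e_{j₀}`. -/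
def addF {n : ℕ} (J : Fin n → ℕ) (j0 : Fin n) : Fin n → ℕ :=
  fun j => J j + (if j = j0 then 1 else 0)

/-- The raw value of `B_α X`:
`(B_α X) = Sym_{(j_0,…,j_{r_α})} Alt_{(i_0,…,i_k)} [ δ^{j_0}_{i_0} X^{(j_1,…,j_{r_α})}_{i_1,…,i_k} ]`,
written in multi-index form. -/
noncomputable def Bval {n k s : ℕ} {r : Fin s → ℕ} (α : Fin s) (X : TT n k s r)
    {k' : ℕ} (i : Fin k' → Fin n) (K : Fin s → (Fin n → ℕ)) : ℝ :=
  if hk : k' = k + 1 then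
    ((k'.factorial : ℕ) : ℝ)⁻¹ *
      ∑ τ : Equiv.Perm (Fin k'),
        ((Equiv.Perm.sign τ : ℤ) : ℝ) *
          ((K α (i (τ ⟨0, by omega⟩)) : ℝ) / ((r α : ℝ) + 1)) *
          appT X (fun l : Fin k => i (τ (Fin.cast hk.symm l.succ)))
            (Function.update K α (subF (K α) (i (τ ⟨0, by omega⟩))))
  else 0

/-- The operator `B_α : ℋ_{k;r_1,…,r_α,…,r_s} → ℋ_{k+1;r_1,…,r_α+1,…,r_s}`. -/
noncomputable def Bop {n k s : ℕ} {r : Fin s → ℕ} (α : Fin s) (X : TT n k s r) :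
    TT n (k+1) s (Function.update r α (r α + 1)) :=
  fun i I => Bval α X i (fun β => (I β).1)

/-- The raw value of the trace `T_α X`. -/
noncomputable def Tval {n k s : ℕ} {r : Fin s → ℕ} (α : Fin s) (X : TT n k s r)
    {k' : ℕ} (i : Fin k' → Fin n) (K : Fin s → (Fin n → ℕ)) : ℝ :=
  ∑ j : Fin n, appT X (Fin.cons j i) (Function.update K α (addF (K α) j))

/-- The trace `T_α : ℋ_{k;r_1,…,r_α,…,r_s} → ℋ_{k−1;r_1,…,r_α−1,…,r_s}`. -/
noncomputable def Top {n k s : ℕ} {r : Fin s → ℕ} (α : Fin s) (X : TT n k s r) :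
    TT n (k-1) s (Function.update r α (r α - 1)) :=
  fun i I => Tval α X i (fun β => (I β).1)

/-- The degree function produced by successive applications of the operators `B_α`,
`α` running through a list. -/
def chainDeg {s : ℕ} (r : Fin s → ℕ) : List (Fin s) → (Fin s → ℕ)
  | [] => r
  | α :: l => Function.update (chainDeg r l) α (chainDeg r l α + 1)

/-- Iterated application `B_{α_1} ∘ ⋯ ∘ B_{α_t}` along a list `[α_1, …, α_t]`
(the head applied last), each `B` acting on the space produced by the previous ones. -/
noncomputable def chainB {n k s : ℕ} {r : Fin s → ℕ} :
    (l : List (Fin s)) → TT n k s r → TT n (k + l.length) s (chainDeg r l)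
  | [], X => X
  | α :: l, X => Bop α (chainB l X)

/-- The exponential generating series of a tensor. -/
noncomputable def genS {n k s : ℕ} {r : Fin s → ℕ} (X : TT n k s r) (i : Fin k → Fin n) :
    MvPowerSeries (Fin s × Fin n) ℝ :=
  fun K => appT X i (fun α j => K (α, j)) * (∏ p, ((K p).factorial : ℝ))⁻¹

theorem coeff_genS {n k s : ℕ} {r : Fin s → ℕ} (X : TT n k s r) (i : Fin k → Fin n)
    (K : Fin s × Fin n →₀ ℕ) : MvPowerSeries.coeff K (genS X i) =
      appT X i (fun α j => K (α, j)) * (∏ p, ((K p).factorial : ℝ))⁻¹ := rfl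

theorem sum_subF {n : ℕ} (J : Fin n → ℕ) (j : Fin n) (h : 1 ≤ J j) :
    (∑ a, subF J j a) + 1 = ∑ a, J a := by
  have h1 : ∀ a, J a = subF J j a + (if a = j then 1 else 0) := by
    intro a
    unfold subF
    split_ifs with h2
    · subst h2; omega
    · omega
  conv_rhs => rw [Finset.sum_congr rfl (fun a _ => h1 a), Finset.sum_add_distrib]
  simp

theorem appT_Bop {n k s : ℕ} {r : Fin s → ℕ} (α : Fin s) (X : TT n k s r)
    (i : Fin (k+1) → Fin n) (K : Fin s → (Fin n → ℕ)) :
    appT (Bop α X) i K = Bval α X i K := by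
  unfold appT
  split_ifs with h
  · rfl
  · symm
    unfold Bval
    rw [dif_pos rfl]
    apply mul_eq_zero_of_right
    apply Finset.sum_eq_zero
    intro τ _
    by_cases h0 : K α (i (τ ⟨0, by omega⟩)) = 0
    · rw [h0]; simp
    · apply mul_eq_zero_of_right
      unfold appT
      rw [dif_neg]
      rintro ⟨-, h2⟩
      apply h
      refine ⟨rfl, fun β => ?_⟩
      have h3 := h2 β
      by_cases hβ : β = α
      · subst hβ
        simp only [Function.update_self] at h3 ⊢
        rw [← h3, sum_subF _ _ (by omega)]
      · simpa [Function.update_of_ne hβ] using h3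

theorem genS_Bop {n k s : ℕ} {r : Fin s → ℕ} (α : Fin s) (X : TT n k s r)
    (i : Fin (k+1) → Fin n) :
    genS (Bop α X) i = ((((k+1).factorial : ℝ)⁻¹ * ((r α : ℝ) + 1)⁻¹)) •
      ∑ τ : Equiv.Perm (Fin (k+1)), ((Equiv.Perm.sign τ : ℤ) : MvPowerSeries (Fin s × Fin n) ℝ) *
        (MvPowerSeries.X (α, i (τ 0)) * genS X (fun l => i (τ l.succ))) := by
  ext K
  rw [coeff_genS, appT_Bop, MvPowerSeries.coeff_smul, map_sum]
  unfold Bval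
  rw [dif_pos rfl, mul_assoc, mul_assoc, Finset.sum_mul]
  congr 1
  rw [Finset.mul_sum]
  apply Finset.sum_congr rfl
  intro τ _
  have hs : ((Equiv.Perm.sign τ : ℤ) : MvPowerSeries (Fin s × Fin n) ℝ) =
      MvPowerSeries.C ((Equiv.Perm.sign τ : ℤ) : ℝ) := by simp
  rw [hs, MvPowerSeries.coeff_C_mul, MvPowerSeries.X, MvPowerSeries.coeff_monomial_mul]
  have e0 : (⟨0, by omega⟩ : Fin (k+1)) = 0 := rfl
  rw [e0]
  set j := i (τ 0) with hj
  by_cases h0 : K (α, j) = 0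
  · rw [if_neg]
    · simp [h0]
    · intro hle
      have := hle (α, j)
      simp [h0] at this
  · rw [if_pos (by rw [Finsupp.single_le_iff]; omega), coeff_genS]
    have hK : (fun β a => (K - Finsupp.single (α, j) 1 : Fin s × Fin n →₀ ℕ) (β, a)) =
        Function.update (fun β a => K (β, a)) α (subF (fun a => K (α, a)) j) := by
      funext β a
      by_cases hβ : β = α
      · subst hβ
        simp [subF, Finsupp.single_apply, eq_comm]
      · rw [Function.update_of_ne hβ]
        simp [Finsupp.single_apply, Ne.symm hβ]
    have hf : (∏ p, ((K p).factorial : ℝ)) = (K (α, j) : ℝ) *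
        ∏ p, (((K - Finsupp.single (α, j) 1 : Fin s × Fin n →₀ ℕ) p).factorial : ℝ) := by
      rw [← Finset.mul_prod_erase _ _ (Finset.mem_univ (α, j)),
        ← Finset.mul_prod_erase (a := (α, j)) _
          (fun p => (((K - Finsupp.single (α, j) 1 : Fin s × Fin n →₀ ℕ) p).factorial : ℝ)) (Finset.mem_univ _),
        ← mul_assoc]
      congr 1
      · rw [Finsupp.tsub_apply, Finsupp.single_eq_same]
        exact_mod_cast (Nat.mul_factorial_pred h0).symm
      · apply Finset.prod_congr rfl
        intro p hp
        rw [Finsupp.tsub_apply, Finsupp.single_eq_of_ne (Finset.ne_of_mem_erase hp)]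
        simp
    rw [hK, hf]
    have h0' : (K (α, j) : ℝ) ≠ 0 := by exact_mod_cast h0
    rw [mul_inv]
    simp only [Fin.cast_eq_self]
    field_simp

theorem det_sum {R : Type*} [CommRing R] {k : ℕ} (M : Matrix (Fin (k+1)) (Fin (k+1)) R) :
    ∑ τ : Equiv.Perm (Fin (k+1)), ((Equiv.Perm.sign τ : ℤ) : R) *
      (M 0 (τ 0) * Matrix.det (Matrix.of fun a b : Fin k => M a.succ (τ b.succ))) =
      (k.factorial : R) * M.det := by
  have h1 : ∀ τ : Equiv.Perm (Fin (k+1)), ((Equiv.Perm.sign τ : ℤ) : R) *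
      (M 0 (τ 0) * Matrix.det (Matrix.of fun a b : Fin k => M a.succ (τ b.succ))) =
      ∑ σ : Equiv.Perm (Fin k), ((Equiv.Perm.sign (τ * Equiv.Perm.decomposeFin.symm (0, σ)) : ℤ) : R) *
        ∏ b, M b ((τ * Equiv.Perm.decomposeFin.symm (0, σ)) b) := by
    intro τ
    rw [← Matrix.det_transpose, Matrix.det_apply', Finset.mul_sum, Finset.mul_sum]
    apply Finset.sum_congr rfl
    intro σ _
    rw [Fin.prod_univ_succ]
    simp only [Equiv.Perm.mul_apply, Equiv.Perm.decomposeFin_symm_apply_zero,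
      Equiv.Perm.decomposeFin_symm_apply_succ, Equiv.swap_self, Equiv.refl_apply,
      Equiv.Perm.sign_mul, Equiv.Perm.decomposeFin.symm_sign, Matrix.transpose_apply,
      Matrix.of_apply]
    simp
    ring
  rw [Finset.sum_congr rfl (fun τ _ => h1 τ), Finset.sum_comm]
  have h2 : ∀ σ : Equiv.Perm (Fin k), (∑ τ : Equiv.Perm (Fin (k+1)),
      ((Equiv.Perm.sign (τ * Equiv.Perm.decomposeFin.symm (0, σ)) : ℤ) : R) *
        ∏ b, M b ((τ * Equiv.Perm.decomposeFin.symm (0, σ)) b)) = M.det := by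
    intro σ
    rw [← Matrix.det_transpose, Matrix.det_apply']
    exact Equiv.sum_comp (Equiv.mulRight (Equiv.Perm.decomposeFin.symm (0, σ)))
      (fun τ : Equiv.Perm (Fin (k+1)) => ((Equiv.Perm.sign τ : ℤ) : R) * ∏ b, M b (τ b))
  rw [Finset.sum_congr rfl (fun σ _ => h2 σ)]
  simp [Fintype.card_perm]

theorem chain_alg {R ι : Type*} [CommRing R] [Algebra ℝ R] [Fintype ι] (A c : ℝ) (f : ℕ)
    (S x d : ι → R) (G D : R) (h : ∑ τ, S τ * (x τ * d τ) = (f : R) * D) :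
    A • ∑ τ, S τ * (x τ * (c • (d τ * G))) = (A * c * (f : ℝ)) • (D * G) := by
  have h1 : ∑ τ, S τ * (x τ * (c • (d τ * G))) = c • ((∑ τ, S τ * (x τ * d τ)) * G) := by
    rw [Finset.sum_mul, Finset.smul_sum]
    apply Finset.sum_congr rfl
    intro τ _
    rw [mul_smul_comm, mul_smul_comm]
    congr 1
    ring
  rw [h1, h, mul_smul, mul_smul, Nat.cast_smul_eq_nsmul, nsmul_eq_mul, mul_assoc]

theorem genS_chain {n s : ℕ} {r : Fin s → ℕ} (X : TT n 0 s r) (l : List (Fin s)) :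
    ∃ c : ℝ, c ≠ 0 ∧ ∀ i : Fin (0 + l.length) → Fin n, genS (chainB l X) i =
      c • (Matrix.det (Matrix.of fun a b : Fin (0 + l.length) =>
        (MvPowerSeries.X (l.get (a.cast (Nat.zero_add _)), i b) :
          MvPowerSeries (Fin s × Fin n) ℝ)) * genS X Fin.elim0) := by
  induction l with
  | nil =>
    refine ⟨1, one_ne_zero, fun i => ?_⟩
    have hi : i = Fin.elim0 := funext fun a => Fin.elim0 a
    have hd : ∀ M : Matrix (Fin (0 + 0)) (Fin (0 + 0)) (MvPowerSeries (Fin s × Fin n) ℝ),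
      M.det = 1 := fun M => Matrix.det_fin_zero
    rw [one_smul, hi]
    erw [hd]
    rw [one_mul]
    rfl
  | cons α l ih =>
    obtain ⟨c, hc, ih⟩ := ih
    refine ⟨((((0 + l.length)+1).factorial : ℝ)⁻¹ * ((chainDeg r l α : ℝ) + 1)⁻¹) * c *
      ((0 + l.length).factorial : ℝ), ?_, fun i => ?_⟩
    · positivity
    · have h1 := genS_Bop α (chainB l X) i
      have h2 := det_sum (k := 0 + l.length)
        (Matrix.of fun a b : Fin (0 + l.length + 1) =>
        (MvPowerSeries.X ((α :: l).get (a.cast (Nat.zero_add _)), i b) :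
          MvPowerSeries (Fin s × Fin n) ℝ))
      refine h1.trans ?_
      simp only [ih]
      exact chain_alg _ c _ _ _ _ _ _ h2

theorem det_ne {n q : ℕ} (f : Fin q → Fin n) (hf : Function.Injective f) :
    Matrix.det (Matrix.of fun a b : Fin q =>
        (MvPowerSeries.X (a, f b) : MvPowerSeries (Fin q × Fin n) ℝ)) ≠ 0 := by
  have h1 : Matrix.det (Matrix.of fun a b : Fin q =>
        (MvPowerSeries.X (a, f b) : MvPowerSeries (Fin q × Fin n) ℝ)) =
      MvPolynomial.coeToMvPowerSeries.ringHom (Matrix.det (Matrix.of fun a b : Fin q =>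
        (MvPolynomial.X (a, f b) : MvPolynomial (Fin q × Fin n) ℝ))) := by
    rw [RingHom.map_det]
    congr 1
    ext1 a b
    simp
  rw [h1]
  intro h
  have h2 : Matrix.det (Matrix.of fun a b : Fin q =>
        (MvPolynomial.X (a, f b) : MvPolynomial (Fin q × Fin n) ℝ)) = 0 := by
    apply MvPolynomial.coe_injective
    simpa using h
  have h3 := congrArg (MvPolynomial.eval
    (fun p : Fin q × Fin n => if f p.1 = p.2 then (1 : ℝ) else 0)) h2
  rw [RingHom.map_det, map_zero] at h3
  have h4 : (MvPolynomial.eval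
    (fun p : Fin q × Fin n => if f p.1 = p.2 then (1 : ℝ) else 0)).mapMatrix
      (Matrix.of fun a b : Fin q =>
        (MvPolynomial.X (a, f b) : MvPolynomial (Fin q × Fin n) ℝ)) = 1 := by
    ext a b
    simp [Matrix.one_apply, hf.eq_iff]
  rw [h4, Matrix.det_one] at h3
  exact one_ne_zero h3

/-- if `X ∈ ℋ_{0;r_1,…,r_q}` with `2 ≤ q ≤ n` satisfies
`B_1 ⋯ B_q X = 0`, then `X = 0`. -/
theorem fock_injectivity (n q : ℕ) (hn : 2 ≤ n) (hq : 2 ≤ q) (hqn : q ≤ n)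
    (r : Fin q → ℕ) (X : TT n 0 q r)
    (h : chainB (List.finRange q) X = 0) : X = 0 := by
  obtain ⟨c, hc, hg⟩ := genS_chain X (List.finRange q)
  have hl : 0 + (List.finRange q).length = q := by simp
  have hi := hg (fun a => Fin.castLE hqn (a.cast hl))
  have hz : genS (chainB (List.finRange q) X) (fun a => Fin.castLE hqn (a.cast hl)) = 0 := by
    rw [h]
    ext K
    rw [coeff_genS]
    simp [appT]
  rw [hz] at hi
  have hdet : Matrix.det (Matrix.of fun a b : Fin (0 + (List.finRange q).length) =>
        (MvPowerSeries.X ((List.finRange q).get (a.cast (Nat.zero_add _)),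
          Fin.castLE hqn (b.cast hl)) : MvPowerSeries (Fin q × Fin n) ℝ)) ≠ 0 := by
    have h1 := det_ne (Fin.castLE hqn) (Fin.castLE_injective hqn)
    rw [← Matrix.det_submatrix_equiv_self (finCongr hl)] at h1
    convert h1 using 2
    ext1 a b
    simp
    rfl
  have hG : genS X Fin.elim0 = 0 := by
    rcases smul_eq_zero.mp hi.symm with h1 | h1
    · exact absurd h1 hc
    · exact (mul_eq_zero.mp h1).resolve_left hdet
  funext i I
  have h5 := congrArg (MvPowerSeries.coeff
    (Finsupp.equivFunOnFinite.symm (fun p : Fin q × Fin n => (I p.1).1 p.2))) hG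
  rw [coeff_genS, map_zero] at h5
  have h6 := (mul_eq_zero.mp h5).resolve_right
    (inv_ne_zero (Finset.prod_ne_zero_iff.mpr fun p _ => by positivity))
  unfold appT at h6
  rw [dif_pos ⟨rfl, fun α => by simpa using (I α).2⟩] at h6
  have e1 : i = fun a => Fin.elim0 a := funext fun a => Fin.elim0 a
  rw [e1]
  exact h6

end FockVar
end

section
/- Let 0 ≤ k < n, let 1 ≤ s ≤ n with s + k ≤ n, and let r_1, …, r_s ∈ ℕ. An element X ∈ ℋ_{k; r_1,…,r_s} satisfies (B_1 ∘ ⋯ ∘ B_s) X = 0 if and only if there exist X_α ∈ ℋ_{k−1; r_1,…,r_{α−1}, r_α−1, r_{α+1},…,r_s} (α = 1,…,s) such that X = Σ_{α=1}^{s} B_α X_α. (For k = 0 the spaces on the right are zero, so the condition forces X = 0.) -/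
open scoped BigOperators

namespace FockVar

/-- The big untyped Fock space. -/
abbrev FS (n s : ℕ) : Type := List (Fin n) → (Fin s → Fin n → ℕ) → ℝ

def upK {n s : ℕ} (α : Fin s) (j : Fin n) (K : Fin s → Fin n → ℕ) : Fin s → Fin n → ℕ :=
  fun β l => K β l + if β = α ∧ l = j then 1 else 0

def dnK {n s : ℕ} (α : Fin s) (j : Fin n) (K : Fin s → Fin n → ℕ) : Fin s → Fin n → ℕ :=
  fun β l => K β l - if β = α ∧ l = j then 1 else 0

lemma dn_up {n s : ℕ} (α : Fin s) (j : Fin n) (K) : dnK α j (upK α j K) = K := by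
  funext β l; simp [dnK, upK]

lemma up_dn {n s : ℕ} (α : Fin s) (j : Fin n) (K : Fin s → Fin n → ℕ) (h : K α j ≠ 0) :
    upK α j (dnK α j K) = K := by
  funext β l; simp only [dnK, upK]
  split_ifs with h1
  · obtain ⟨rfl, rfl⟩ := h1; omega
  · simp

lemma dn_up_ne {n s : ℕ} (α β : Fin s) (j l : Fin n) (K : Fin s → Fin n → ℕ)
    (h : ¬ (β = α ∧ l = j)) :
    dnK β l (upK α j K) = upK α j (dnK β l K) := by
  funext γ m; simp only [dnK, upK]
  split_ifs with h1 h2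
  · exfalso; apply h; exact ⟨by rw [← h1.1, ← h2.1], by rw [← h1.2, ← h2.2]⟩
  all_goals omega

lemma dn_dn {n s : ℕ} (α β : Fin s) (j l : Fin n) (K : Fin s → Fin n → ℕ) :
    dnK β l (dnK α j K) = dnK α j (dnK β l K) := by
  funext γ m; simp only [dnK]; omega

lemma upK_eq {n s : ℕ} (α : Fin s) (j : Fin n) (K : Fin s → Fin n → ℕ) :
    upK α j K = Function.update K α (addF (K α) j) := by
  funext β l; by_cases h : β = α
  · subst h; simp [upK, addF]
  · simp [upK, h]

lemma dnK_eq {n s : ℕ} (α : Fin s) (j : Fin n) (K : Fin s → Fin n → ℕ) :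
    dnK α j K = Function.update K α (subF (K α) j) := by
  funext β l; by_cases h : β = α
  · subst h; simp [dnK, subF]
  · simp [dnK, h]

lemma sum_upK {n s : ℕ} (α : Fin s) (j : Fin n) (K : Fin s → Fin n → ℕ) (β : Fin s) :
    ((∑ l, upK α j K β l : ℕ) : ℤ) = (∑ l, K β l : ℕ) + (Pi.single α 1 : Fin s → ℤ) β := by
  by_cases h : β = α
  · subst h; simp [upK, Finset.sum_add_distrib]
  · simp [upK, h]

lemma sum_dnK {n s : ℕ} (α : Fin s) (j : Fin n) (K : Fin s → Fin n → ℕ) (h : K α j ≠ 0)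
    (β : Fin s) :
    ((∑ l, dnK α j K β l : ℕ) : ℤ) = (∑ l, K β l : ℕ) - (Pi.single α 1 : Fin s → ℤ) β := by
  have := sum_upK α j (dnK α j K) β
  rw [up_dn _ _ _ h] at this
  omega

/-- interior product -/
def iota {n s : ℕ} (j : Fin n) : Module.End ℝ (FS n s) where
  toFun f := fun L K => f (j :: L) K
  map_add' _ _ := rfl
  map_smul' _ _ := rfl

def epsFun {n s : ℕ} (l : Fin n) : List (Fin n) → FS n s → (Fin s → Fin n → ℕ) → ℝ
  | [], _, _ => 0
  | a :: L, f, K => (if a = l then f L K else 0) - epsFun l L (iota a f) K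

lemma epsFun_add {n s : ℕ} (l : Fin n) (L : List (Fin n)) (f g : FS n s) (K) :
    epsFun l L (f + g) K = epsFun l L f K + epsFun l L g K := by
  induction L generalizing f g with
  | nil => simp [epsFun]
  | cons a L ih => 
    simp only [epsFun, map_add, ih, Pi.add_apply]; split_ifs <;> ring

lemma epsFun_smul {n s : ℕ} (l : Fin n) (L : List (Fin n)) (c : ℝ) (f : FS n s) (K) :
    epsFun l L (c • f) K = c * epsFun l L f K := by
  induction L generalizing f with
  | nil => simp [epsFun]
  | cons a L ih => 
    simp only [epsFun, map_smul, ih, Pi.smul_apply, smul_eq_mul]; split_ifs <;> ring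

/-- exterior product -/
def eps {n s : ℕ} (l : Fin n) : Module.End ℝ (FS n s) where
  toFun f := fun L K => epsFun l L f K
  map_add' f g := by funext L K; exact epsFun_add ..
  map_smul' c f := by funext L K; exact epsFun_smul ..

def xm {n s : ℕ} (α : Fin s) (j : Fin n) : Module.End ℝ (FS n s) where
  toFun f := fun L K => (K α j : ℝ) * f L (dnK α j K)
  map_add' f g := by funext L K; simp [mul_add]
  map_smul' c f := by funext L K; simp; ring

def dd {n s : ℕ} (α : Fin s) (j : Fin n) : Module.End ℝ (FS n s) where
  toFun f := fun L K => f L (upK α j K)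
  map_add' _ _ := rfl
  map_smul' _ _ := rfl

lemma iota_apply {n s : ℕ} (j : Fin n) (f : FS n s) (L K) : iota j f L K = f (j :: L) K := rfl
lemma eps_nil {n s : ℕ} (j : Fin n) (f : FS n s) (K) : eps j f [] K = 0 := rfl
lemma eps_cons {n s : ℕ} (j a : Fin n) (f : FS n s) (L K) :
    eps j f (a :: L) K = (if a = j then f L K else 0) - eps j (iota a f) L K := rfl
lemma xm_apply {n s : ℕ} (α : Fin s) (j : Fin n) (f : FS n s) (L K) :
    xm α j f L K = (K α j : ℝ) * f L (dnK α j K) := rfl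
lemma dd_apply {n s : ℕ} (α : Fin s) (j : Fin n) (f : FS n s) (L K) :
    dd α j f L K = f L (upK α j K) := rfl

lemma iota_eps {n s : ℕ} (j l : Fin n) :
    (iota j * eps l : Module.End ℝ (FS n s)) = (if j = l then 1 else 0) - eps l * iota j := by
  ext f L K
  simp only [Module.End.mul_apply, iota_apply, eps_cons, LinearMap.sub_apply, Pi.sub_apply]
  split_ifs <;> simp

lemma iota_xm {n s : ℕ} (j l : Fin n) (α : Fin s) :
    (iota j * xm α l : Module.End ℝ (FS n s)) = xm α l * iota j := rfl
lemma iota_dd {n s : ℕ} (j l : Fin n) (α : Fin s) :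
    (iota j * dd α l : Module.End ℝ (FS n s)) = dd α l * iota j := rfl

lemma eps_xm {n s : ℕ} (j l : Fin n) (α : Fin s) :
    (eps j * xm α l : Module.End ℝ (FS n s)) = xm α l * eps j := by
  ext f L K
  simp only [Module.End.mul_apply]
  induction L generalizing f with
  | nil => simp [eps_nil, xm_apply]
  | cons a L ih =>
    rw [eps_cons, ← Module.End.mul_apply (iota a), iota_xm, Module.End.mul_apply, ih]
    simp only [xm_apply, eps_cons]
    split_ifs <;> ring

lemma eps_dd {n s : ℕ} (j l : Fin n) (α : Fin s) :
    (eps j * dd α l : Module.End ℝ (FS n s)) = dd α l * eps j := by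
  ext f L K
  simp only [Module.End.mul_apply]
  induction L generalizing f with
  | nil => simp [eps_nil, dd_apply]
  | cons a L ih =>
    rw [eps_cons, ← Module.End.mul_apply (iota a), iota_dd, Module.End.mul_apply, ih]
    simp only [dd_apply, eps_cons]

lemma eps_eps {n s : ℕ} (j l : Fin n) :
    (eps j * eps l : Module.End ℝ (FS n s)) = - (eps l * eps j) := by
  ext f L K
  simp only [Module.End.mul_apply, LinearMap.neg_apply, Pi.neg_apply]
  induction L generalizing f with
  | nil => simp [eps_nil]
  | cons a L ih =>
    rw [eps_cons, eps_cons, ← Module.End.mul_apply (iota a), iota_eps,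
      ← Module.End.mul_apply (iota a), iota_eps]
    simp only [LinearMap.sub_apply, map_sub, Pi.sub_apply, Module.End.mul_apply, ih]
    split_ifs <;> simp <;> ring

lemma xm_xm {n s : ℕ} (α β : Fin s) (j l : Fin n) :
    (xm α j * xm β l : Module.End ℝ (FS n s)) = xm β l * xm α j := by
  ext f L K
  by_cases h : α = β ∧ j = l
  · obtain ⟨rfl, rfl⟩ := h; rfl
  simp only [Module.End.mul_apply, xm_apply]
  have h1 : dnK α j K β l = K β l := by
    simp only [dnK]; rw [if_neg (by tauto)]; simp
  have h2 : dnK β l K α j = K α j := by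
    simp only [dnK]; rw [if_neg (by tauto)]; simp
  rw [h1, h2, dn_dn]; ring

lemma dd_xm {n s : ℕ} (α β : Fin s) (j l : Fin n) :
    (dd α j * xm β l : Module.End ℝ (FS n s)) =
      xm β l * dd α j + if α = β ∧ j = l then 1 else 0 := by
  ext f L K
  by_cases h : α = β ∧ j = l
  · obtain ⟨rfl, rfl⟩ := h
    simp only [Module.End.mul_apply, xm_apply, dd_apply, dn_up, LinearMap.add_apply, Pi.add_apply]
    by_cases h0 : K α j = 0
    · simp [upK, h0]
    · rw [up_dn _ _ _ h0]; simp [upK]; ring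
  · simp only [Module.End.mul_apply, xm_apply, dd_apply, LinearMap.add_apply, Pi.add_apply]
    rw [dn_up_ne _ _ _ _ _ (by tauto), if_neg h]
    have : upK α j K β l = K β l := by
      simp only [upK]; rw [if_neg (by tauto)]; simp
    simp [this]

def B {n s : ℕ} (α : Fin s) : Module.End ℝ (FS n s) := ∑ j, xm α j * eps j
def T {n s : ℕ} (α : Fin s) : Module.End ℝ (FS n s) := ∑ j, dd α j * iota j
def E {n s : ℕ} (β α : Fin s) : Module.End ℝ (FS n s) := ∑ j, xm β j * dd α j
def Ncomp {n s : ℕ} : Module.End ℝ (FS n s) := ∑ j, iota j * eps j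

lemma end_neg_mul {M : Type*} [AddCommGroup M] [Module ℝ M] (a b : Module.End ℝ M) :
    -a * b = -(a * b) := by ext; simp

lemma end_mul_neg {M : Type*} [AddCommGroup M] [Module ℝ M] (a b : Module.End ℝ M) :
    a * -b = -(a * b) := by ext; simp

lemma B_B {n s : ℕ} (α β : Fin s) : (B α * B β : Module.End ℝ (FS n s)) = - (B β * B α) := by
  simp only [B, Finset.sum_mul_sum]
  rw [Finset.sum_comm, ← Finset.sum_neg_distrib]
  refine Finset.sum_congr rfl fun j _ => ?_
  rw [← Finset.sum_neg_distrib]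
  refine Finset.sum_congr rfl fun l _ => ?_
  calc xm α l * eps l * (xm β j * eps j) = xm α l * (eps l * xm β j) * eps j := by noncomm_ring
    _ = (xm α l * xm β j) * (eps l * eps j) := by rw [eps_xm]; noncomm_ring
    _ = - (xm β j * (xm α l * eps j) * eps l) := by rw [xm_xm, eps_eps, end_mul_neg]; simp only [mul_assoc]
    _ = _ := by rw [← eps_xm]; noncomm_ring

lemma B_sq {n s : ℕ} (α : Fin s) : (B α * B α : Module.End ℝ (FS n s)) = 0 :=
  by
  have h := B_B (n := n) α α
  ext f L K
  have h1 := congrFun (congrFun (LinearMap.congr_fun h f) L) K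
  simp only [LinearMap.neg_apply, Pi.neg_apply] at h1
  simp only [LinearMap.zero_apply, Pi.zero_apply]
  linarith

lemma T_B {n s : ℕ} (α β : Fin s) : (T α * B β : Module.End ℝ (FS n s)) =
    E β α + (if α = β then Ncomp else 0) - B β * T α := by
  have key : ∀ j l : Fin n, (dd α j * iota j * (xm β l * eps l) : Module.End ℝ (FS n s)) =
      (if j = l then xm β l * dd α j else 0) + (if α = β ∧ j = l then iota j * eps l else 0)
        - xm β l * eps l * (dd α j * iota j) := by
    intro j l
    calc (dd α j * iota j * (xm β l * eps l) : Module.End ℝ (FS n s))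
        = dd α j * (iota j * xm β l) * eps l := by noncomm_ring
      _ = (dd α j * xm β l) * (iota j * eps l) := by rw [iota_xm]; noncomm_ring
      _ = xm β l * dd α j * (iota j * eps l) +
            (if α = β ∧ j = l then iota j * eps l else 0) := by
          rw [dd_xm, add_mul]; split_ifs <;> simp
      _ = (if j = l then xm β l * dd α j else 0) - xm β l * (dd α j * eps l) * iota j +
            (if α = β ∧ j = l then iota j * eps l else 0) := by
          rw [iota_eps, mul_sub]
          simp only [mul_assoc]
          split_ifs <;> simp
      _ = _ := by rw [← eps_dd]; noncomm_ring
  simp only [T, B, E, Ncomp, Finset.sum_mul_sum, key, Finset.sum_sub_distrib,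
    Finset.sum_add_distrib]
  congr 1
  · congr 1
    · simp
    · split_ifs with h <;> simp [h]
  · rw [Finset.sum_comm]

lemma E_B {n s : ℕ} (γ α β : Fin s) : (E γ α * B β : Module.End ℝ (FS n s)) =
    B β * E γ α + (if α = β then B γ else 0) := by
  have key : ∀ j l : Fin n, (xm γ j * dd α j * (xm β l * eps l) : Module.End ℝ (FS n s)) =
      xm β l * eps l * (xm γ j * dd α j) + (if α = β ∧ j = l then xm γ j * eps l else 0) := by
    intro j l
    calc (xm γ j * dd α j * (xm β l * eps l) : Module.End ℝ (FS n s))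
        = xm γ j * (dd α j * xm β l) * eps l := by noncomm_ring
      _ = (xm γ j * xm β l) * (dd α j * eps l) + 
            (if α = β ∧ j = l then xm γ j * eps l else 0) := by
          rw [dd_xm, mul_add, add_mul]
          simp only [mul_assoc]
          split_ifs <;> simp
      _ = xm β l * (xm γ j * eps l) * dd α j + 
            (if α = β ∧ j = l then xm γ j * eps l else 0) := by
          rw [xm_xm, ← eps_dd]; noncomm_ring
      _ = _ := by rw [← eps_xm]; noncomm_ring
  simp only [B, E, Finset.sum_mul_sum, key, Finset.sum_add_distrib]
  congr 1
  · rw [Finset.sum_comm]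
  · split_ifs with h <;> simp [h]

/-- homogeneous alternating elements -/
def Alt {n s : ℕ} (f : FS n s) : Prop :=
  ∀ L0 a b L K, f (L0 ++ a :: b :: L) K = - f (L0 ++ b :: a :: L) K

def Supp {n s : ℕ} (k : ℤ) (r : Fin s → ℤ) (f : FS n s) : Prop :=
  ∀ L K, f L K ≠ 0 → (L.length : ℤ) = k ∧ ∀ α, ((∑ j, K α j : ℕ) : ℤ) = r α

def HH (n : ℕ) {s : ℕ} (k : ℤ) (r : Fin s → ℤ) : Submodule ℝ (FS n s) where
  carrier := {f | Alt f ∧ Supp k r f}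
  zero_mem' := ⟨fun _ _ _ _ _ => by simp, fun L K h => by simp at h⟩
  add_mem' := by
    rintro f g ⟨hf, hf'⟩ ⟨hg, hg'⟩
    refine ⟨fun L0 a b L K => ?_, fun L K h => ?_⟩
    · simp only [Pi.add_apply]; rw [hf, hg]; ring
    · by_cases h1 : f L K = 0
      · exact hg' _ _ (by simpa [h1] using h)
      · exact hf' _ _ h1
  smul_mem' := by
    rintro c f ⟨hf, hf'⟩
    refine ⟨fun L0 a b L K => ?_, fun L K h => ?_⟩
    · simp only [Pi.smul_apply]; rw [hf]; simp
    · exact hf' _ _ (by intro h1; simp [h1] at h)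

lemma Alt.iota {n s : ℕ} {f : FS n s} (hf : Alt f) (j) : Alt (iota j f) := by
  intro L0 a b L K
  exact hf (j :: L0) a b L K

lemma Alt.iota_iota {n s : ℕ} {f : FS n s} (hf : Alt f) (a b) :
    FockVar.iota a (FockVar.iota b f) = - FockVar.iota b (FockVar.iota a f) := by
  funext L K
  exact hf [] b a L K

lemma Alt.eps {n s : ℕ} {f : FS n s} (hf : Alt f) (j) : Alt (eps j f) := by
  intro L0 a b L K
  induction L0 generalizing f with
  | nil =>
    simp only [List.nil_append, eps_cons]
    rw [hf.iota_iota a b, map_neg]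
    simp only [iota_apply, Pi.neg_apply]
    ring
  | cons c L0 ih =>
    simp only [List.cons_append, eps_cons]
    rw [ih (hf.iota c), hf]
    split_ifs <;> ring

lemma Ncomp_alt {n s : ℕ} {f : FS n s} (hf : Alt f) (L K) :
    Ncomp f L K = ((n : ℝ) - L.length) * f L K := by
  have h1 : ∀ (f : FS n s), Alt f → ∑ j, eps j (iota j f) L K = L.length * f L K := by
    induction L with
    | nil => intro f _; simp [eps_nil]
    | cons a L ih =>
      intro f hf
      simp only [eps_cons, Finset.sum_sub_distrib]
      have : ∀ j, eps j (iota a (iota j f)) L K = - eps j (iota j (iota a f)) L K := by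
        intro j; rw [hf.iota_iota a j, map_neg]; rfl
      simp only [this, Finset.sum_neg_distrib, ih _ (hf.iota a)]
      simp [iota_apply]; ring
  have h2 : (Ncomp : Module.End ℝ (FS n s)) = (n : ℝ) • 1 - ∑ j, eps j * iota j := by
    simp only [Ncomp, iota_eps, if_true, Finset.sum_sub_distrib]
    congr 1
    ext; simp
  rw [h2]
  simp only [LinearMap.sub_apply, LinearMap.sum_apply, LinearMap.smul_apply, Module.End.mul_apply,
    Pi.sub_apply, Finset.sum_apply, h1 f hf]
  simp; ring

lemma Ncomp_HH {n s : ℕ} {k : ℤ} {r : Fin s → ℤ} {f : FS n s} (hf : f ∈ HH n k r) :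
    Ncomp f = ((n : ℝ) - k) • f := by
  funext L K
  rw [Ncomp_alt hf.1]
  by_cases h : f L K = 0
  · simp [h]
  · have := (hf.2 L K h).1
    simp [← this]

lemma E_HH {n s : ℕ} {k : ℤ} {r : Fin s → ℤ} {f : FS n s} (hf : f ∈ HH n k r) (α : Fin s) :
    E α α f = (r α : ℝ) • f := by
  funext L K
  have : ∀ j, xm α j (dd α j f) L K = K α j * f L K := by
    intro j
    simp only [xm_apply, dd_apply]
    by_cases h0 : K α j = 0
    · simp [h0]
    · rw [up_dn _ _ _ h0]
  simp only [E, LinearMap.sum_apply, Module.End.mul_apply, Finset.sum_apply, this]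
  rw [← Finset.sum_mul]
  by_cases h : f L K = 0
  · simp [h]
  · have := (hf.2 L K h).2 α
    simp [← this]

lemma HH_zero {n s : ℕ} {k : ℤ} {r : Fin s → ℤ} {f : FS n s} (hf : f ∈ HH n k r)
    (h : k < 0 ∨ ∃ α, r α < 0) : f = 0 := by
  funext L K
  by_contra h0
  obtain ⟨h1, h2⟩ := hf.2 L K h0
  rcases h with h | ⟨α, h⟩
  · omega
  · have := h2 α; omega

lemma xm_mem {n s : ℕ} {k : ℤ} {r : Fin s → ℤ} {f : FS n s} (hf : f ∈ HH n k r) (α : Fin s) (j) :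
    xm α j f ∈ HH n k (r + Pi.single α 1) := by
  refine ⟨fun L0 a b L K => ?_, fun L K h => ?_⟩
  · simp only [xm_apply]; rw [hf.1]; ring
  · simp only [xm_apply] at h
    have h1 := hf.2 _ _ (right_ne_zero_of_mul h)
    refine ⟨h1.1, fun β => ?_⟩
    have h2 := h1.2 β
    rw [sum_dnK _ _ _ (by exact_mod_cast left_ne_zero_of_mul h)] at h2
    simp only [Pi.add_apply]; linarith

lemma dd_mem {n s : ℕ} {k : ℤ} {r : Fin s → ℤ} {f : FS n s} (hf : f ∈ HH n k r) (α : Fin s) (j) :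
    dd α j f ∈ HH n k (r - Pi.single α 1) := by
  refine ⟨fun L0 a b L K => ?_, fun L K h => ?_⟩
  · simp only [dd_apply]; rw [hf.1]
  · simp only [dd_apply] at h
    have h1 := hf.2 _ _ h
    refine ⟨h1.1, fun β => ?_⟩
    have h2 := h1.2 β
    rw [sum_upK] at h2
    simp only [Pi.sub_apply]; linarith

lemma iota_mem {n s : ℕ} {k : ℤ} {r : Fin s → ℤ} {f : FS n s} (hf : f ∈ HH n k r) (j) :
    iota j f ∈ HH n (k - 1) r := by
  refine ⟨hf.1.iota j, fun L K h => ?_⟩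
  have h1 := hf.2 _ _ h
  refine ⟨?_, h1.2⟩
  have := h1.1
  simp at this
  omega

lemma Supp.eps {n s : ℕ} {k : ℤ} {r : Fin s → ℤ} {f : FS n s} (hf : Supp k r f) (j) :
    Supp (k+1) r (FockVar.eps j f) := by
  intro L K
  induction L generalizing f k with
  | nil => simp [eps_nil]
  | cons a L ih =>
    intro h
    rw [eps_cons] at h
    by_cases h1 : FockVar.eps j (FockVar.iota a f) L K = 0
    · have h2 : f L K ≠ 0 := by
        intro h2; simp [h1, h2] at h
      have := hf _ _ h2
      simp; exact ⟨this.1, by simpa using this.2⟩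
    · have h3 : Supp (k-1) r (FockVar.iota a f) := by
        intro L K h
        have := hf _ _ h
        simp at this
        exact ⟨by omega, by simpa using this.2⟩
      have := ih h3 h1
      refine ⟨?_, this.2⟩
      simp; omega

lemma eps_mem {n s : ℕ} {k : ℤ} {r : Fin s → ℤ} {f : FS n s} (hf : f ∈ HH n k r) (j) :
    eps j f ∈ HH n (k + 1) r := ⟨hf.1.eps j, hf.2.eps j⟩

lemma B_mem {n s : ℕ} {k : ℤ} {r : Fin s → ℤ} {f : FS n s} (hf : f ∈ HH n k r) (α) :
    B α f ∈ HH n (k + 1) (r + Pi.single α 1) := by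
  simp only [B, LinearMap.sum_apply, Module.End.mul_apply]
  exact Submodule.sum_mem _ fun j _ => xm_mem (eps_mem hf j) α j

lemma T_mem {n s : ℕ} {k : ℤ} {r : Fin s → ℤ} {f : FS n s} (hf : f ∈ HH n k r) (α) :
    T α f ∈ HH n (k - 1) (r - Pi.single α 1) := by
  simp only [T, LinearMap.sum_apply, Module.End.mul_apply]
  exact Submodule.sum_mem _ fun j _ => dd_mem (iota_mem hf j) α j

lemma E_mem {n s : ℕ} {k : ℤ} {r : Fin s → ℤ} {f : FS n s} (hf : f ∈ HH n k r) (β α) :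
    E β α f ∈ HH n k (r - Pi.single α 1 + Pi.single β 1) := by
  simp only [E, LinearMap.sum_apply, Module.End.mul_apply]
  exact Submodule.sum_mem _ fun j _ => xm_mem (dd_mem hf α j) β j

/-- products of the `B`s -/
def BL {n s : ℕ} (l : List (Fin s)) : Module.End ℝ (FS n s) := (l.map B).prod

lemma BL_cons {n s : ℕ} (a : Fin s) (l : List (Fin s)) :
    (BL (a :: l) : Module.End ℝ (FS n s)) = B a * BL l := by simp [BL]

lemma BL_comm {n s : ℕ} (a : Fin s) (l : List (Fin s)) :
    ∃ c : ℝ, c ≠ 0 ∧ (B a * BL l : Module.End ℝ (FS n s)) = c • (BL l * B a) := by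
  induction l with
  | nil => exact ⟨1, one_ne_zero, by simp [BL]⟩
  | cons b l ih =>
    obtain ⟨c, hc, h⟩ := ih
    refine ⟨-c, neg_ne_zero.mpr hc, ?_⟩
    rw [BL_cons, ← mul_assoc, B_B, end_neg_mul, mul_assoc, h]
    ext f L K; simp

lemma BL_erase {n s : ℕ} (a : Fin s) (l : List (Fin s)) (ha : a ∈ l) :
    ∃ c : ℝ, c ≠ 0 ∧ (BL l : Module.End ℝ (FS n s)) = c • (BL (l.erase a) * B a) := by
  induction l with
  | nil => simp at ha
  | cons b l ih =>
    by_cases hb : b = a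
    · subst hb
      obtain ⟨c, hc, h⟩ := BL_comm (n := n) b l
      exact ⟨c, hc, by simpa [BL_cons] using h⟩
    · obtain ⟨c, hc, h⟩ := ih (by simpa [Ne.symm hb] using ha)
      refine ⟨c, hc, ?_⟩
      rw [List.erase_cons_tail (by simpa using hb), BL_cons, BL_cons, h]
      simp [mul_assoc]

lemma BL_mul_B {n s : ℕ} (a : Fin s) (l : List (Fin s)) (ha : a ∈ l) :
    (BL l * B a : Module.End ℝ (FS n s)) = 0 := by
  obtain ⟨c, hc, h⟩ := BL_erase (n := n) a l ha
  rw [h]; simp [mul_assoc, B_sq]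

def Dec (n : ℕ) {s : ℕ} (l : List (Fin s)) (k : ℤ) (r : Fin s → ℤ) : Submodule ℝ (FS n s) :=
  ⨆ α ∈ l.toFinset, (HH n (k - 1) (r - Pi.single α 1)).map (B α)

lemma mem_Dec {n s : ℕ} {l : List (Fin s)} {k : ℤ} {r : Fin s → ℤ} {f : FS n s} {α : Fin s}
    (hα : α ∈ l) (hf : f ∈ HH n (k - 1) (r - Pi.single α 1)) : B α f ∈ Dec n l k r :=
  (le_iSup₂_of_le (f := fun α (_ : α ∈ l.toFinset) =>
    (HH n (k - 1) (r - Pi.single α 1)).map (B α)) α (by simpa using hα) le_rfl)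
    (Submodule.mem_map_of_mem hf)

lemma Dec_exists {n s : ℕ} {l : List (Fin s)} {k : ℤ} {r : Fin s → ℤ} {f : FS n s}
    (hf : f ∈ Dec n l k r) : ∃ g : Fin s → FS n s,
      (∀ α, g α ∈ HH n (k - 1) (r - Pi.single α 1)) ∧ f = ∑ α ∈ l.toFinset, B α (g α) := by
  obtain ⟨μ, hμ⟩ := (Submodule.mem_iSup_finset_iff_exists_sum _ _).mp hf
  choose g hg hg' using fun α => Submodule.mem_map.mp (μ α).2
  exact ⟨g, hg, by simp only [hg', hμ]⟩

lemma E_Dec {n s : ℕ} {l : List (Fin s)} {k : ℤ} {r : Fin s → ℤ} {f : FS n s} {β α : Fin s}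
    (hβ : β ∈ l) (hf : f ∈ Dec n l k r) :
    E β α f ∈ Dec n l k (r - Pi.single α 1 + Pi.single β 1) := by
  obtain ⟨g, hg, rfl⟩ := Dec_exists hf
  rw [map_sum]
  refine Submodule.sum_mem _ fun γ hγ => ?_
  rw [← Module.End.mul_apply, E_B, LinearMap.add_apply]
  refine Submodule.add_mem _ ?_ ?_
  · refine mem_Dec (by simpa using hγ) ?_
    convert E_mem (hg γ) β α using 1
    congr 1; abel
  · split_ifs with h
    · subst h
      refine mem_Dec hβ ?_
      convert hg α using 2
      abel
    · simp

theorem main {n s : ℕ} (l : List (Fin s)) (hl : l.Nodup) : ∀ (k : ℤ), k + l.length ≤ n →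
    ∀ (r : Fin s → ℤ) (f : FS n s), f ∈ HH n k r → BL l f = 0 → f ∈ Dec n l k r := by
  induction l with
  | nil => intro k _ r f _ h; simp [BL] at h; simp [h]
  | cons a l ih =>
    intro k hk
    have ih := ih hl.of_cons
    have hal : a ∉ l := (List.nodup_cons.mp hl).1
    suffices H : ∀ (N : ℕ) (r : Fin s → ℤ) (f : FS n s), ∑ α ∈ l.toFinset, (r α).toNat < N →
        f ∈ HH n k r → BL (a :: l) f = 0 → f ∈ Dec n (a :: l) k r from
      fun r f => H _ r f (Nat.lt_succ_self _)
    intro N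
    induction N with
    | zero => intro r f h; omega
    | succ N ihN =>
      intro r f hN hf h0
      by_cases hra : r a < 0
      · rw [HH_zero hf (Or.inr ⟨a, hra⟩)]; exact Submodule.zero_mem _
      have h1 : BL l (B a f) = 0 := by
        obtain ⟨c, hc, h⟩ := BL_comm (n := n) a l
        rw [BL_cons, h] at h0
        simpa [hc] using h0
      have hk' : k + l.length + 1 ≤ n := by simp at hk; omega
      have h2 := ih (k + 1) (by omega) _ _ (B_mem hf a) h1
      obtain ⟨Y, hY, hsum⟩ := Dec_exists h2
      -- each Y lies in the kernel
      have hY0 : ∀ α ∈ l.toFinset, BL (a :: l) (Y α) = 0 := by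
        intro α hα
        have hα' : α ∈ l := by simpa using hα
        obtain ⟨c, hc, h⟩ := BL_erase (n := n) α (a :: l) (by simp [hα'])
        have h3 := congrArg (BL ((a :: l).erase α)) hsum
        have haα : a ≠ α := fun h => hal (h ▸ hα')
        rw [map_sum, ← Module.End.mul_apply, BL_mul_B a _ 
          (by rw [List.mem_erase_of_ne haα]; simp),
          Finset.sum_eq_single_of_mem α hα] at h3
        · rw [h, LinearMap.smul_apply, Module.End.mul_apply, ← h3]; simp
        · intro β hβ hne
          rw [← Module.End.mul_apply, BL_mul_B β _ 
            (by rw [List.mem_erase_of_ne hne]; simpa using Or.inr hβ)]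
          rfl
      have hYD : ∀ α ∈ l.toFinset, E α a (Y α) ∈ Dec n (a :: l) k r := by
        intro α hα
        have hα' : α ∈ l := by simpa using hα
        have haα : a ≠ α := fun h => hal (h ▸ hα')
        have hYα := hY α
        rw [add_sub_cancel_right] at hYα
        by_cases hr : r α ≤ 0
        · rw [HH_zero hYα (Or.inr ⟨α, by simp [haα.symm]; omega⟩)]
          simp
        · have := ihN _ (Y α) ?_ hYα (hY0 α hα)
          · have := E_Dec (β := α) (α := a) (by simp [hα']) this
            convert this using 2
            abel
          · refine lt_of_lt_of_le (Finset.sum_lt_sum (g := fun β => (r β).toNat) ?_ ⟨α, hα, ?_⟩)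
              (Nat.le_of_lt_succ hN)
            · intro β hβ
              have : β ≠ a := fun h => hal (by simpa [h] using hβ)
              by_cases hβα : β = α
              · subst hβα; simp [this]
              · simp [this, hβα]
            · simp [haα.symm]; omega
      have h4 := congrArg (T a) hsum
      rw [map_sum, ← Module.End.mul_apply, T_B, if_pos rfl] at h4
      simp only [LinearMap.sub_apply, LinearMap.add_apply, E_HH hf, Ncomp_HH hf,
        Module.End.mul_apply] at h4
      have h5 : ∀ α ∈ l.toFinset, T a (B α (Y α)) = E α a (Y α) - B α (T a (Y α)) := by
        intro α hα
        have haα : a ≠ α := fun h => hal (by simpa [h] using hα)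
        rw [← Module.End.mul_apply, T_B, if_neg haα]; simp
      rw [Finset.sum_congr rfl h5, ← add_smul, sub_eq_iff_eq_add] at h4
      have hc : (r a : ℝ) + ((n : ℝ) - k) ≠ 0 := by
        have : (0 : ℤ) < r a + (n - k) := by omega
        have : (0 : ℝ) < ((r a + (n - k) : ℤ) : ℝ) := by exact_mod_cast this
        push_cast at this
        exact this.ne'
      rw [← Submodule.smul_mem_iff _ hc, h4]
      refine Submodule.add_mem _ (Submodule.sum_mem _ fun α hα => 
        Submodule.sub_mem _ (hYD α hα) ?_) ?_
      · refine mem_Dec (List.mem_cons_of_mem _ (by simpa using hα)) ?_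
        convert T_mem (hY α) a using 2
        · ring
        · abel
      · exact mem_Dec (by simp) (T_mem hf a)

/-! ### Bridge to the typed tensors -/

def lift {n k s : ℕ} {r : Fin s → ℕ} (X : TT n k s r) : FS n s :=
  fun L K => appT X L.get K

lemma lift_ofFn {n k s : ℕ} {r : Fin s → ℕ} (X : TT n k s r) {k' : ℕ} (i : Fin k' → Fin n) (K) :
    lift X (List.ofFn i) K = appT X i K := by
  have : ∀ (L : List (Fin n)) (h : L.length = k'), appT X L.get K =
      appT X (fun a : Fin k' => L.get (Fin.cast h.symm a)) K := by
    intro L h; subst h; rfl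
  rw [lift, this _ (by simp)]
  congr 1
  funext a; simp

lemma lift_val {n k s : ℕ} {r : Fin s → ℕ} (X : TT n k s r) (i : Fin k → Fin n)
    (I : (α : Fin s) → MIe n (r α)) :
    lift X (List.ofFn i) (fun β => (I β).1) = X i I := by
  rw [lift_ofFn, appT, dif_pos ⟨rfl, fun α => (I α).2⟩]
  rfl

lemma exists_ofFn {n k : ℕ} (L : List (Fin n)) (h : L.length = k) :
    ∃ i : Fin k → Fin n, L = List.ofFn i := by
  subst h; exact ⟨L.get, by simp⟩

lemma lift_supp {n k s : ℕ} {r : Fin s → ℕ} (X : TT n k s r) :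
    Supp (k : ℤ) (fun α => (r α : ℤ)) (lift X) := by
  intro L K h
  rw [lift, appT] at h
  split_ifs at h with h1
  · exact ⟨by exact_mod_cast h1.1, fun α => by simp only [h1.2 α]⟩
  · simp at h

lemma supp_ext {n k s : ℕ} {r : Fin s → ℕ} {f g : FS n s}
    (hf : Supp (k : ℤ) (fun α => (r α : ℤ)) f) (hg : Supp (k : ℤ) (fun α => (r α : ℤ)) g)
    (h : ∀ (i : Fin k → Fin n) (I : (α : Fin s) → MIe n (r α)),
      f (List.ofFn i) (fun β => (I β).1) = g (List.ofFn i) (fun β => (I β).1)) : f = g := by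
  funext L K
  by_cases h1 : L.length = k ∧ ∀ α, ∑ j, K α j = r α
  · obtain ⟨i, rfl⟩ := exists_ofFn L h1.1
    exact h i (fun α => ⟨K α, h1.2 α⟩)
  · have : ∀ f : FS n s, Supp (k : ℤ) (fun α => (r α : ℤ)) f → f L K = 0 := by
      intro f hf
      by_contra h0
      have := hf L K h0
      exact h1 ⟨by exact_mod_cast this.1, fun α => Nat.cast_injective (R := ℤ) (this.2 α)⟩
    rw [this f hf, this g hg]

lemma eps_ofFn {n s : ℕ} (l : Fin n) {k : ℕ} (f : FS n s) (i : Fin (k + 1) → Fin n) (K) :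
    eps l f (List.ofFn i) K =
      ∑ a : Fin (k + 1), (-1 : ℝ) ^ (a : ℕ) *
        if i a = l then f (List.ofFn (i ∘ a.succAbove)) K else 0 := by
  induction k generalizing f with
  | zero =>
    simp [eps_cons, eps_nil]
  | succ k ih =>
    rw [List.ofFn_succ, eps_cons, ih, Fin.sum_univ_succ (n := k + 1), sub_eq_add_neg, ← Finset.sum_neg_distrib]
    congr 1
    · simp [Function.comp_def]
    · refine Finset.sum_congr rfl fun a _ => ?_
      rw [List.ofFn_succ (f := i ∘ a.succ.succAbove)]
      simp only [Function.comp_apply, Fin.succ_succAbove_zero, Fin.succ_succAbove_succ,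
        iota_apply, Fin.val_succ, pow_succ]
      simp only [Function.comp_def]
      ring

lemma B_ofFn {n s : ℕ} (α : Fin s) {k : ℕ} (f : FS n s) (i : Fin (k + 1) → Fin n) (K) :
    B α f (List.ofFn i) K =
      ∑ a : Fin (k + 1), (-1 : ℝ) ^ (a : ℕ) *
        (K α (i a) * f (List.ofFn (i ∘ a.succAbove)) (dnK α (i a) K)) := by
  simp only [B, LinearMap.sum_apply, Module.End.mul_apply, Finset.sum_apply, xm_apply, eps_ofFn,
    Finset.mul_sum]
  rw [Finset.sum_comm]
  refine Finset.sum_congr rfl fun a _ => ?_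
  rw [Finset.sum_eq_single (i a)]
  · simp; ring
  · intro b _ hb; simp [hb.symm]
  · simp

lemma Alt.swap {n s : ℕ} {m : ℕ} {f : FS n s} (hf : Alt f) (i : Fin (m + 1) → Fin n) (p : Fin m) (K) :
    f (List.ofFn (i ∘ Equiv.swap p.castSucc p.succ)) K = - f (List.ofFn i) K := by
  induction m generalizing f with
  | zero => exact p.elim0
  | succ m ih =>
    induction p using Fin.cases with
    | zero =>
      rw [List.ofFn_succ, List.ofFn_succ, List.ofFn_succ (f := i), List.ofFn_succ (f := fun j => i j.succ)]
      refine Eq.trans ?_ (hf [] (i 1) (i 0) (List.ofFn fun j : Fin m => i j.succ.succ) K)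
      simp only [List.nil_append, Function.comp_apply, Fin.castSucc_zero, Fin.succ_zero_eq_one,
        Equiv.swap_apply_left, Equiv.swap_apply_right]
      congr 3
    | succ p =>
      have h0 : ∀ j : Fin (m+1), Equiv.swap p.succ.castSucc p.succ.succ j.succ =
          (Equiv.swap p.castSucc p.succ j).succ := by
        intro j
        rw [← Fin.succ_castSucc]
        simp only [Equiv.swap_apply_def, Fin.succ_inj]
        split_ifs <;> rfl
      rw [List.ofFn_succ, List.ofFn_succ (f := i)]
      simp only [Function.comp_apply, h0]
      rw [Equiv.swap_apply_of_ne_of_ne (by simp [Fin.ext_iff]) (by simp [Fin.ext_iff])]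
      exact ih (hf.iota (i 0)) (fun j => i j.succ) p

lemma Alt.perm {n s : ℕ} {m : ℕ} {f : FS n s} (hf : Alt f) (i : Fin m → Fin n)
    (τ : Equiv.Perm (Fin m)) (K) :
    f (List.ofFn (i ∘ τ)) K = ((Equiv.Perm.sign τ : ℤ) : ℝ) * f (List.ofFn i) K := by
  cases m with
  | zero => rw [Subsingleton.elim τ 1]; simp
  | succ m =>
    have hτ : τ ∈ Submonoid.closure (Set.range fun i : Fin m => Equiv.swap i.castSucc i.succ) := by
      rw [Equiv.Perm.mclosure_swap_castSucc_succ]; trivial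
    induction hτ using Submonoid.closure_induction generalizing i with
    | mem x hx =>
      obtain ⟨p, rfl⟩ := hx
      rw [hf.swap, Equiv.Perm.sign_swap (by simp [Fin.ext_iff])]; simp
    | one => simp
    | mul x y _ _ hx hy =>
      rw [Equiv.Perm.coe_mul, ← Function.comp_assoc, hy, hx, map_mul]
      push_cast; ring

lemma lift_alt {n k s : ℕ} {r : Fin s → ℕ} {X : TT n k s r} (hX : IsAnti X) : Alt (lift X) := by
  intro L0 a b L K
  by_cases h : (L0 ++ a :: b :: L).length = k ∧ ∀ α, ∑ j, K α j = r α
  · obtain ⟨h1, h2⟩ := h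
    obtain ⟨i, hi⟩ := exists_ofFn _ h1
    have h1' : (L0 ++ b :: a :: L).length = k := by simpa using h1
    obtain ⟨i', hi'⟩ := exists_ofFn _ h1'
    have hlen : L0.length + 1 < k := by simp at h1; omega
    have e1 : ∀ x : Fin k, i x = (L0 ++ a :: b :: L)[(x : ℕ)]'(by rw [h1]; exact x.2) := by
      intro x; simp [hi]
    have e2 : ∀ x : Fin k, i' x = (L0 ++ b :: a :: L)[(x : ℕ)]'(by rw [h1']; exact x.2) := by
      intro x; simp [hi']
    have key : i = i' ∘ Equiv.swap (⟨L0.length, by omega⟩ : Fin k) ⟨L0.length + 1, hlen⟩ := by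
      funext x
      simp only [Function.comp_apply, Equiv.swap_apply_def]
      split_ifs with hx hx
      · subst hx; rw [e1, e2]; simp
      · subst hx; rw [e1, e2]; simp
      · rw [e1, e2]
        have hx1 : (x : ℕ) ≠ L0.length := fun h => by simp [Fin.ext_iff] at *; omega
        have hx2 : (x : ℕ) ≠ L0.length + 1 := fun h => by simp [Fin.ext_iff] at *; omega
        by_cases h3 : (x : ℕ) < L0.length
        · rw [List.getElem_append_left h3, List.getElem_append_left h3]
        · rw [List.getElem_append_right (by omega), List.getElem_append_right (by omega)]
          obtain ⟨d, hd⟩ : ∃ d, (x : ℕ) - L0.length = d + 2 := ⟨x - L0.length - 2, by omega⟩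
          simp [hd]
    have := lift_val X i (fun α => ⟨K α, h2 α⟩)
    have h' := lift_val X i' (fun α => ⟨K α, h2 α⟩)
    simp only at this h'
    rw [hi, hi', this, h', key, hX, Equiv.Perm.sign_swap (by simp [Fin.ext_iff])]
    simp
  · have : ∀ L', L'.length = (L0 ++ a :: b :: L).length → lift X L' K = 0 := by
      intro L' hL'
      rw [lift, appT, dif_neg]
      rw [hL']; exact h
    rw [this _ rfl, this _ (by simp)]; simp

lemma lift_mem {n k s : ℕ} {r : Fin s → ℕ} {X : TT n k s r} (hX : IsAnti X) :
    lift X ∈ HH n (k : ℤ) (fun α => (r α : ℤ)) := ⟨lift_alt hX, lift_supp X⟩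

lemma Bval_eq {n k s : ℕ} {r : Fin s → ℕ} {X : TT n k s r} (hX : IsAnti X) (α : Fin s)
    (i : Fin (k + 1) → Fin n) (K) :
    Bval α X i K = (((k : ℝ) + 1) * ((r α : ℝ) + 1))⁻¹ * B α (lift X) (List.ofFn i) K := by
  set g : (Fin (k + 1) → Fin n) → ℝ := fun i =>
    K α (i 0) * lift X (List.ofFn (fun l : Fin k => i l.succ)) (dnK α (i 0) K) with hg
  have h1 : Bval α X i K = (((k + 1).factorial : ℕ) : ℝ)⁻¹ * ((r α : ℝ) + 1)⁻¹ *
      ∑ τ : Equiv.Perm (Fin (k + 1)), ((Equiv.Perm.sign τ : ℤ) : ℝ) * g (i ∘ τ) := by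
    rw [Bval, dif_pos rfl, mul_assoc]
    congr 1
    rw [Finset.mul_sum]
    refine Finset.sum_congr rfl fun τ _ => ?_
    simp only [hg, lift_ofFn, Function.comp_apply, dnK_eq, Fin.cast_refl, id]
    change _ * ((K α (i (τ 0)) : ℝ) / _) * appT X _ (Function.update K α (subF (K α) (i (τ 0)))) = _
    rw [div_eq_mul_inv]
    ring
  have h2 : ∀ i' : Fin (k + 1) → Fin n, B α (lift X) (List.ofFn i') K =
      ∑ a : Fin (k + 1), (-1 : ℝ) ^ (a : ℕ) * g (i' ∘ a.cycleRange.symm) := by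
    intro i'
    rw [B_ofFn]
    refine Finset.sum_congr rfl fun a _ => ?_
    simp only [hg, Function.comp_apply, Fin.cycleRange_symm_zero, Fin.cycleRange_symm_succ]
    rfl
  have hB : Alt (B α (lift X)) := (B_mem (lift_mem hX) α).1
  have h3 : (((k + 1).factorial : ℕ) : ℝ) * B α (lift X) (List.ofFn i) K =
      ((k : ℝ) + 1) * ∑ τ : Equiv.Perm (Fin (k + 1)), ((Equiv.Perm.sign τ : ℤ) : ℝ) * g (i ∘ τ) := by
    have e1 : ∑ τ : Equiv.Perm (Fin (k + 1)), ((Equiv.Perm.sign τ : ℤ) : ℝ) *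
        B α (lift X) (List.ofFn (i ∘ τ)) K =
        (((k + 1).factorial : ℕ) : ℝ) * B α (lift X) (List.ofFn i) K := by
      have : ∀ τ : Equiv.Perm (Fin (k + 1)), ((Equiv.Perm.sign τ : ℤ) : ℝ) *
          B α (lift X) (List.ofFn (i ∘ τ)) K = B α (lift X) (List.ofFn i) K := by
        intro τ
        rw [hB.perm, ← mul_assoc]
        rcases Int.units_eq_one_or (Equiv.Perm.sign τ) with h | h <;> simp [h]
      simp only [this, Finset.sum_const, Finset.card_univ, Fintype.card_perm, Fintype.card_fin,
        nsmul_eq_mul]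
    rw [← e1]
    simp only [h2, Finset.mul_sum]
    rw [Finset.sum_comm]
    have e2 : ∀ a : Fin (k + 1), ∑ τ : Equiv.Perm (Fin (k + 1)), ((Equiv.Perm.sign τ : ℤ) : ℝ) *
        ((-1 : ℝ) ^ (a : ℕ) * g ((i ∘ τ) ∘ a.cycleRange.symm)) =
        ∑ τ : Equiv.Perm (Fin (k + 1)), ((Equiv.Perm.sign τ : ℤ) : ℝ) * g (i ∘ τ) := by
      intro a
      rw [← Equiv.sum_comp (Equiv.mulRight a.cycleRange)]
      refine Finset.sum_congr rfl fun τ _ => ?_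
      have e3 : (i ∘ (Equiv.mulRight a.cycleRange τ : Equiv.Perm (Fin (k + 1)))) ∘
          a.cycleRange.symm = i ∘ τ := by
        funext x; simp
      rw [e3]
      simp only [Equiv.coe_mulRight, map_mul, Fin.sign_cycleRange]
      push_cast
      have : (-1 : ℝ) ^ (a : ℕ) * (-1 : ℝ) ^ (a : ℕ) = 1 := by
        rw [← mul_pow]; simp
      linear_combination ((Equiv.Perm.sign τ : ℤ) : ℝ) * g (i ∘ τ) * this
    rw [Finset.sum_congr rfl fun a _ => e2 a]
    simp [Finset.mul_sum]
  rw [h1]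
  have hf : (((k + 1).factorial : ℕ) : ℝ) ≠ 0 := by positivity
  have hk : (k : ℝ) + 1 ≠ 0 := by positivity
  have hr : (r α : ℝ) + 1 ≠ 0 := by positivity
  field_simp
  linarith

lemma update_cast {s : ℕ} (r : Fin s → ℕ) (α : Fin s) :
    (fun β => ((Function.update r α (r α + 1) β : ℕ) : ℤ)) =
      (fun β => (r β : ℤ)) + Pi.single α 1 := by
  funext β
  by_cases h : β = α
  · subst h; simp
  · simp [h]

lemma lift_Bop {n k s : ℕ} {r : Fin s → ℕ} {X : TT n k s r} (hX : IsAnti X) (α : Fin s) :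
    lift (Bop α X) = (((k : ℝ) + 1) * ((r α : ℝ) + 1))⁻¹ • B α (lift X) := by
  have hm := Submodule.smul_mem _ (((k : ℝ) + 1) * ((r α : ℝ) + 1))⁻¹ (B_mem (lift_mem hX) α)
  refine supp_ext (lift_supp _) ?_ ?_
  · have := hm.2
    rw [update_cast]; exact_mod_cast this
  · intro i I
    rw [lift_val, Bop, Bval_eq hX]; rfl

lemma anti_of_alt {n s : ℕ} {f : FS n s} (hf : Alt f) (k : ℕ) (r : Fin s → ℕ) :
    IsAnti (fun i I => f (List.ofFn i) (fun β => (I β).1) : TT n k s r) :=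
  fun τ i _ => hf.perm i τ _

lemma Bop_anti {n k s : ℕ} {r : Fin s → ℕ} {X : TT n k s r} (hX : IsAnti X) (α : Fin s) :
    IsAnti (Bop α X) := by
  have h := anti_of_alt (f := lift (Bop α X)) ?_ (k + 1) (Function.update r α (r α + 1))
  · intro τ i I
    have := h τ i I
    simpa only [lift_val] using this
  · rw [lift_Bop hX]
    exact (Submodule.smul_mem _ _ (B_mem (lift_mem hX) α)).1

lemma lift_chain {n k s : ℕ} {r : Fin s → ℕ} {X : TT n k s r} (hX : IsAnti X) (l : List (Fin s)) :
    IsAnti (chainB l X) ∧ ∃ c : ℝ, c ≠ 0 ∧ lift (chainB l X) = c • BL l (lift X) := by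
  induction l with
  | nil => exact ⟨hX, 1, one_ne_zero, by simp [BL, chainB]; rfl⟩
  | cons a l ih =>
    obtain ⟨h1, c, hc, h2⟩ := ih
    refine ⟨Bop_anti h1 a, ((((k + l.length : ℕ) : ℝ) + 1) * ((chainDeg r l a : ℝ) + 1))⁻¹ * c, ?_, ?_⟩
    rotate_left
    · refine Eq.trans (lift_Bop h1 a) ?_
      rw [h2, map_smul, smul_smul, BL_cons]
      rfl
    · refine mul_ne_zero (inv_ne_zero ?_) hc
      positivity

lemma chain_zero_iff {n k s : ℕ} {r : Fin s → ℕ} {X : TT n k s r} (hX : IsAnti X)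
    (l : List (Fin s)) : chainB l X = 0 ↔ BL l (lift X) = 0 := by
  obtain ⟨-, c, hc, h⟩ := lift_chain hX l
  constructor
  · intro h0
    have : lift (chainB l X) = 0 := by
      rw [h0]; funext L K; simp [lift, appT]
    rw [h] at this
    simpa [hc] using this
  · intro h0
    rw [h0, smul_zero] at h
    funext i I
    rw [← lift_val (chainB l X), h]; rfl

lemma Bval_zero {n k s : ℕ} {r : Fin s → ℕ} (α : Fin s) {k' : ℕ} (i : Fin k' → Fin n) (K) :
    Bval α (0 : TT n k s r) i K = 0 := by
  simp [Bval, appT]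

lemma Bval_degen {n k s : ℕ} (r : Fin s → ℕ) (α : Fin s)
    (X' : TT n (k-1) s (Function.update r α (r α - 1))) (h : k = 0 ∨ r α = 0)
    (i : Fin k → Fin n) (I : (β : Fin s) → MIe n (r β)) :
    Bval α X' i (fun β => (I β).1) = 0 := by
  rcases h with h | h
  · rw [Bval, dif_neg (by omega)]
  · have h0 : ∀ j, (I α).1 j = 0 := by
      intro j
      have := (I α).2.trans h
      exact (Finset.sum_eq_zero_iff.mp this) j (Finset.mem_univ j)
    rw [Bval]
    split_ifs
    · simp [h0]
    · rfl

lemma Bval_nondegen {n k s : ℕ} (r : Fin s → ℕ) (α : Fin s)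
    (X' : TT n (k-1) s (Function.update r α (r α - 1))) (hX' : IsAnti X') (hk : k ≠ 0)
    (hr : r α ≠ 0) (i : Fin k → Fin n) (K) :
    Bval α X' i K = ((k : ℝ) * (r α : ℝ))⁻¹ * B α (lift X') (List.ofFn i) K := by
  obtain ⟨k, rfl⟩ := Nat.exists_eq_succ_of_ne_zero hk
  have h := Bval_eq (k := k) hX' α i K
  have h2 : ((r α - 1 : ℕ) : ℝ) + 1 = r α := by
    rw [Nat.cast_sub (by omega)]; simp
  rw [Function.update_self, h2] at h
  push_cast
  exact h

lemma update_cast_sub {s : ℕ} (r : Fin s → ℕ) (α : Fin s) (hr : r α ≠ 0) :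
    (fun β => ((Function.update r α (r α - 1) β : ℕ) : ℤ)) =
      (fun β => (r β : ℤ)) - Pi.single α 1 := by
  funext β
  by_cases h : β = α
  · subst h; simp; omega
  · simp [h]

/-- for `X ∈ ℋ_{k;r_1,…,r_s}` with `0 ≤ k < n`, `1 ≤ s ≤ n`, `s + k ≤ n`,
`B_1 ⋯ B_s X = 0` iff `X = Σ_α B_α X_α` for some
`X_α ∈ ℋ_{k−1;r_1,…,r_α−1,…,r_s}` (for `k = 0` the right-hand spaces are zero and the
condition forces `X = 0`; the formula below implements this convention automatically). -/
theorem fock_kernel_characterization (n k s : ℕ) (hn : 1 ≤ n) (hk : k < n)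
    (hs : 1 ≤ s) (hsn : s ≤ n) (hks : s + k ≤ n)
    (r : Fin s → ℕ) (X : TT n k s r) (hX : IsAnti X) :
    chainB (List.finRange s) X = 0 ↔
      ∃ X' : (α : Fin s) → TT n (k-1) s (Function.update r α (r α - 1)),
        (∀ α, IsAnti (X' α)) ∧
        ∀ (i : Fin k → Fin n) (I : (β : Fin s) → MIe n (r β)),
          X i I = ∑ α : Fin s, Bval α (X' α) i (fun β => (I β).1) := by
  rw [chain_zero_iff hX]
  have hXm := lift_mem hX
  constructor
  · intro h0
    have hD := main (List.finRange s) (List.nodup_finRange s) (k : ℤ) (by simp; omega) _ _ hXm h0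
    obtain ⟨g, hg, hsum⟩ := Dec_exists hD
    simp only [List.toFinset_finRange] at hsum
    refine ⟨fun α i I => ((k : ℝ) * (r α : ℝ)) * g α (List.ofFn i) (fun β => (I β).1), ?_, ?_⟩
    · intro α
      exact anti_of_alt (f := ((k : ℝ) * (r α : ℝ)) • g α) (Submodule.smul_mem _ _ (hg α)).1 _ _
    · intro i I
      rw [← lift_val X, hsum, Finset.sum_apply, Finset.sum_apply]
      refine Finset.sum_congr rfl fun α _ => ?_
      by_cases hd : k = 0 ∨ r α = 0
      · rw [Bval_degen r α _ hd, HH_zero (hg α)]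
        · simp
        · rcases hd with h | h
          · left; omega
          · right; exact ⟨α, by simp [h]⟩
      · push Not at hd
        have hm := Submodule.smul_mem _ ((k : ℝ) * (r α : ℝ)) (hg α)
        have hb := Bval_nondegen r α
          (fun i I => ((k : ℝ) * (r α : ℝ)) * g α (List.ofFn i) (fun β => (I β).1))
          (anti_of_alt (f := ((k : ℝ) * (r α : ℝ)) • g α) hm.1 _ _)
          hd.1 hd.2 i (fun β => (I β).1)
        refine Eq.trans ?_ hb.symm
        have : lift (fun i I => ((k : ℝ) * (r α : ℝ)) * g α (List.ofFn i) (fun β => (I β).1) :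
            TT n (k-1) s (Function.update r α (r α - 1))) = ((k : ℝ) * (r α : ℝ)) • g α := by
          refine supp_ext (lift_supp _) ?_ ?_
          · rw [update_cast_sub _ _ hd.2, Nat.cast_sub (by omega)]
            exact hm.2
          · intro i I
            rw [lift_val]; rfl
        rw [this, map_smul]
        have h1 : (k : ℝ) ≠ 0 := by exact_mod_cast hd.1
        have h2 : (r α : ℝ) ≠ 0 := by exact_mod_cast hd.2
        simp only [Pi.smul_apply, smul_eq_mul]
        field_simp
  · rintro ⟨X', hX', hsum⟩
    have key : ∃ g : Fin s → FS n s, lift X = ∑ α, B α (g α) := by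
      have hg : ∀ α, ∃ g : FS n s, B α g ∈ HH n (k : ℤ) (fun α => (r α : ℤ)) ∧
          ∀ (i : Fin k → Fin n) (I : (β : Fin s) → MIe n (r β)),
            B α g (List.ofFn i) (fun β => (I β).1) = Bval α (X' α) i (fun β => (I β).1) := by
        intro α
        by_cases hd : k = 0 ∨ r α = 0
        · refine ⟨0, by simp, fun i I => ?_⟩
          rw [Bval_degen r α _ hd]; simp
        · push Not at hd
          refine ⟨((k : ℝ) * (r α : ℝ))⁻¹ • lift (X' α), ?_, fun i I => ?_⟩
          · have := B_mem (Submodule.smul_mem _ ((k : ℝ) * (r α : ℝ))⁻¹ (lift_mem (hX' α))) α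
            rw [update_cast_sub _ _ hd.2, Nat.cast_sub (by omega)] at this
            simpa using this
          · rw [Bval_nondegen r α _ (hX' α) hd.1 hd.2, map_smul]; rfl
      choose g hg1 hg2 using hg
      refine ⟨g, supp_ext (lift_supp X) (Submodule.sum_mem _ fun α _ => hg1 α).2 ?_⟩
      intro i I
      rw [lift_val, hsum, Finset.sum_apply, Finset.sum_apply]
      exact Finset.sum_congr rfl fun α _ => (hg2 α i I).symm
    obtain ⟨g, hg⟩ := key
    rw [hg, map_sum]
    refine Finset.sum_eq_zero fun α _ => ?_
    rw [← Module.End.mul_apply, BL_mul_B α _ (List.mem_finRange α)]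
    rfl

end FockVar
end
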